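/- Let Y ~ ST_d(ξ, Ω, α, ν) be a multivariate skew t variate with ν > 4 degrees of freedom. Set δ = Ω̄α/(1 + αᵀΩ̄α)^{1/2}, δ* = (δᵀΩ̄⁻¹δ)^{1/2}, μ* = δ* (ν/π)^{1/2} Γ((ν−1)/2)/Γ(ν/2), σ*² = ν/(ν−2) − μ*², and let β₂* denote the Pearson kurtosis index of a univariate skew t variate ST₁(0,1,α*,ν) with α* = (αᵀΩ̄α)^{1/2}. Then the Mardia multivariate excess kurtosis index of Y is γ_{2,d} = β₂* + (d²−1)(ν−2)/(ν−4) + [2(d−1)/σ*²][ ν/(ν−4) − (ν−1)μ*²/(ν−3) ] − d(d+2). -/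

import Mathlib

open MeasureTheory ProbabilityTheory Matrix

noncomputable section

/-- Standard normal density. -/
def stdNormalPDF (x : ℝ) : ℝ := (Real.sqrt (2 * Real.pi))⁻¹ * Real.exp (-x ^ 2 / 2)

/-- Standard normal cumulative distribution function `Φ`. -/
def stdNormalCDF (x : ℝ) : ℝ := ∫ t in Set.Iic x, stdNormalPDF t

/-- Density `φ_d(x; Ω)` of the centered multivariate normal `N_d(0, Ω)`. -/
def mvnPDF {d : ℕ} (Ωm : Matrix (Fin d) (Fin d) ℝ) (x : Fin d → ℝ) : ℝ :=
  (2 * Real.pi) ^ (-(d : ℝ) / 2) * Ωm.det ^ (-(1 : ℝ) / 2) *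
    Real.exp (-(x ⬝ᵥ (Ωm⁻¹ *ᵥ x)) / 2)

/-- The diagonal matrix `ω` of scale parameters, `ω_ii = √(Ω_ii)`. -/
def scaleMat {d : ℕ} (Ωm : Matrix (Fin d) (Fin d) ℝ) : Matrix (Fin d) (Fin d) ℝ :=
  Matrix.diagonal fun i => Real.sqrt (Ωm i i)

/-- The correlation matrix `Ω̄ = ω⁻¹ Ω ω⁻¹`. -/
def corrMat {d : ℕ} (Ωm : Matrix (Fin d) (Fin d) ℝ) : Matrix (Fin d) (Fin d) ℝ :=
  (scaleMat Ωm)⁻¹ * Ωm * (scaleMat Ωm)⁻¹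

/-- Density of the multivariate skew-normal distribution `SN_d(ξ, Ω, α)`. -/
def snPDF {d : ℕ} (ξ : Fin d → ℝ) (Ωm : Matrix (Fin d) (Fin d) ℝ) (α : Fin d → ℝ)
    (z : Fin d → ℝ) : ℝ :=
  2 * mvnPDF Ωm (z - ξ) * stdNormalCDF (α ⬝ᵥ ((scaleMat Ωm)⁻¹ *ᵥ (z - ξ)))

/-- `Z ~ SN_d(ξ, Ω, α)`. -/
def IsSN {Ω' : Type*} [MeasurableSpace Ω'] (P : Measure Ω') {d : ℕ}
    (Z : Ω' → Fin d → ℝ) (ξ : Fin d → ℝ) (Ωm : Matrix (Fin d) (Fin d) ℝ)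
    (α : Fin d → ℝ) : Prop :=
  Measure.map Z P = volume.withDensity fun z => ENNReal.ofReal (snPDF ξ Ωm α z)

/-- Density of the univariate skew-normal distribution `SN₁(0,1,α)`. -/
def sn1PDF (α x : ℝ) : ℝ := 2 * stdNormalPDF x * stdNormalCDF (α * x)

/-- The vector `δ = Ω̄α / (1 + αᵀΩ̄α)^{1/2}`. -/
def deltaOf {d : ℕ} (Ωb : Matrix (Fin d) (Fin d) ℝ) (α : Fin d → ℝ) : Fin d → ℝ :=
  (Real.sqrt (1 + α ⬝ᵥ (Ωb *ᵥ α)))⁻¹ • (Ωb *ᵥ α)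


/-- Density of the univariate Student `t` distribution with `m` degrees of freedom. -/
def t1PDF (m x : ℝ) : ℝ :=
  Real.Gamma ((m + 1) / 2) / (Real.Gamma (m / 2) * Real.sqrt (m * Real.pi)) *
    (1 + x ^ 2 / m) ^ (-(m + 1) / 2)

/-- Cumulative distribution function `T₁(·; m)` of the univariate Student `t`
distribution with `m` degrees of freedom. -/
def T1CDF (m x : ℝ) : ℝ := ∫ t in Set.Iic x, t1PDF m t

/-- Density of the centered `d`-dimensional Student `t` distribution with scale matrix
`Ω` and `ν` degrees of freedom. -/
def tdPDF {d : ℕ} (Ωm : Matrix (Fin d) (Fin d) ℝ) (ν : ℝ) (x : Fin d → ℝ) : ℝ :=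
  Real.Gamma ((ν + d) / 2) /
      (Real.Gamma (ν / 2) * (ν * Real.pi) ^ ((d : ℝ) / 2) * Real.sqrt Ωm.det) *
    (1 + (x ⬝ᵥ (Ωm⁻¹ *ᵥ x)) / ν) ^ (-(ν + d) / 2)

/-- Density of the multivariate skew `t` distribution `ST_d(ξ, Ω, α, ν)`. -/
def stPDF {d : ℕ} (ξ : Fin d → ℝ) (Ωm : Matrix (Fin d) (Fin d) ℝ) (α : Fin d → ℝ)
    (ν : ℝ) (y : Fin d → ℝ) : ℝ :=
  2 * tdPDF Ωm ν (y - ξ) *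
    T1CDF (ν + d) ((α ⬝ᵥ ((scaleMat Ωm)⁻¹ *ᵥ (y - ξ))) *
      Real.sqrt ((ν + d) / ((y - ξ) ⬝ᵥ (Ωm⁻¹ *ᵥ (y - ξ)) + ν)))

/-- `Y ~ ST_d(ξ, Ω, α, ν)`. -/
def IsST {Ω' : Type*} [MeasurableSpace Ω'] (P : MeasureTheory.Measure Ω') {d : ℕ}
    (Y : Ω' → Fin d → ℝ) (ξ : Fin d → ℝ) (Ωm : Matrix (Fin d) (Fin d) ℝ)
    (α : Fin d → ℝ) (ν : ℝ) : Prop :=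
  Measure.map Y P = volume.withDensity fun y => ENNReal.ofReal (stPDF ξ Ωm α ν y)

/-- Density of the univariate skew `t` distribution `ST₁(0, 1, α, ν)`. -/
def st1PDF (α ν x : ℝ) : ℝ :=
  2 * t1PDF ν x * T1CDF (ν + 1) (α * x * Real.sqrt ((ν + 1) / (x ^ 2 + ν)))

/-- Dilations rescale a Haar measure on a real vector space by the corresponding power. -/
theorem lintegral_eq_mul_lintegral_comp_smul {E : Type*} [NormedAddCommGroup E] [NormedSpace ℝ E]
    [MeasurableSpace E] [BorelSpace E] [FiniteDimensional ℝ E] (μ : Measure E)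
    [μ.IsAddHaarMeasure] {n : ℕ} (hn : Module.finrank ℝ E = n) {r : ℝ} (hr : 0 < r)
    {f : E → ENNReal} (hf : Measurable f) :
    ∫⁻ x, f x ∂μ = ∫⁻ x, ENNReal.ofReal (r ^ n) * f (r • x) ∂μ := by
  have h := lintegral_map (μ := μ) hf (measurable_const_smul r)
  rw [Measure.map_addHaar_smul μ hr.ne', lintegral_smul_measure, hn] at h
  rw [lintegral_const_mul _ (by fun_prop), ← h, smul_eq_mul, ← mul_assoc,
    ← ENNReal.ofReal_mul (by positivity), abs_of_pos (by positivity),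
    mul_inv_cancel₀ (by positivity), ENNReal.ofReal_one, one_mul]

theorem lintegral_Iic_eq_lintegral_Iic_comp_mul {r : ℝ} (hr : 0 < r) (b : ℝ) {f : ℝ → ENNReal}
    (hf : Measurable f) :
    ∫⁻ x in Set.Iic (b * r), f x = ∫⁻ x in Set.Iic b, ENNReal.ofReal r * f (r * x) := by
  rw [← lintegral_indicator measurableSet_Iic, ← lintegral_indicator measurableSet_Iic,
    lintegral_eq_mul_lintegral_comp_smul volume (Module.finrank_self ℝ) hr
      (hf.indicator measurableSet_Iic)]
  refine lintegral_congr fun x => ?_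
  have : r * x ≤ b * r ↔ x ≤ b := by rw [mul_comm b, mul_le_mul_iff_right₀ hr]
  by_cases hx : x ≤ b <;> simp [Set.indicator, hx, this]

theorem stdNormalPDF_eq_gaussianPDFReal : stdNormalPDF = gaussianPDFReal 0 1 := by
  ext x
  simp [stdNormalPDF, gaussianPDFReal]

theorem stdNormalPDF_nonneg (x : ℝ) : 0 ≤ stdNormalPDF x := by
  unfold stdNormalPDF; positivity

@[fun_prop]
theorem continuous_stdNormalPDF : Continuous stdNormalPDF := by
  unfold stdNormalPDF; fun_prop

theorem integrable_stdNormalPDF : Integrable stdNormalPDF := by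
  rw [stdNormalPDF_eq_gaussianPDFReal]; exact integrable_gaussianPDFReal 0 1

theorem integral_stdNormalPDF : ∫ x, stdNormalPDF x = 1 := by
  rw [stdNormalPDF_eq_gaussianPDFReal]; exact integral_gaussianPDFReal_eq_one 0 one_ne_zero

theorem stdNormalCDF_nonneg (x : ℝ) : 0 ≤ stdNormalCDF x :=
  integral_nonneg stdNormalPDF_nonneg

theorem hasDerivAt_stdNormalCDF (x : ℝ) : HasDerivAt stdNormalCDF (stdNormalPDF x) x := by
  have h : stdNormalCDF = fun y => stdNormalCDF 0 + ∫ t in (0 : ℝ)..y, stdNormalPDF t := by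
    ext y
    rw [intervalIntegral.integral_Iic_sub_Iic integrable_stdNormalPDF.integrableOn
      integrable_stdNormalPDF.integrableOn |>.symm]
    simp [stdNormalCDF]
  rw [h]
  exact (intervalIntegral.integral_hasDerivAt_right
    (continuous_stdNormalPDF.intervalIntegrable _ _)
    (continuous_stdNormalPDF.stronglyMeasurableAtFilter _ _)
    continuous_stdNormalPDF.continuousAt).const_add _

@[fun_prop]
theorem continuous_stdNormalCDF : Continuous stdNormalCDF :=
  continuous_iff_continuousAt.2 fun x => (hasDerivAt_stdNormalCDF x).continuousAt

@[fun_prop]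
theorem measurable_stdNormalCDF : Measurable stdNormalCDF := continuous_stdNormalCDF.measurable

theorem stdNormalCDF_le_one (x : ℝ) : stdNormalCDF x ≤ 1 := by
  rw [← integral_stdNormalPDF]
  exact setIntegral_le_integral integrable_stdNormalPDF (ae_of_all _ stdNormalPDF_nonneg)

theorem stdNormalCDF_add_neg (x : ℝ) : stdNormalCDF x + stdNormalCDF (-x) = 1 := by
  have h : stdNormalCDF (-x) = ∫ t in Set.Ioi x, stdNormalPDF t := by
    rw [stdNormalCDF, ← integral_comp_neg_Ioi]
    simp [stdNormalPDF]
  rw [h, stdNormalCDF, ← integral_stdNormalPDF, ← Set.compl_Iic]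
  exact integral_add_compl measurableSet_Iic integrable_stdNormalPDF

theorem lintegral_rpow_mul_exp_neg_mul {a r : ℝ} (ha : 0 < a) (hr : 0 < r) :
    ∫⁻ x in Set.Ioi 0, ENNReal.ofReal (x ^ (a - 1) * Real.exp (-(r * x))) =
      ENNReal.ofReal (Real.Gamma a * r ^ (-a)) := by
  have h := lintegral_gammaPDF_eq_one ha hr
  have h0 : ∫⁻ x, gammaPDF a r x = ∫⁻ x in Set.Ioi 0, gammaPDF a r x := by
    rw [← lintegral_add_compl _ measurableSet_Ici, Set.compl_Ici,
      lintegral_gammaPDF_of_nonpos le_rfl, add_zero, setLIntegral_congr Ioi_ae_eq_Ici]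
  have hG := Real.Gamma_pos_of_pos ha
  rw [h0, setLIntegral_congr_fun (g := fun x => ENNReal.ofReal (r ^ a / Real.Gamma a) *
    ENNReal.ofReal (x ^ (a - 1) * Real.exp (-(r * x)))) measurableSet_Ioi,
    lintegral_const_mul _ (by fun_prop)] at h
  · rw [Real.rpow_neg hr.le, ← div_eq_mul_inv, ← one_div_div,
      ENNReal.ofReal_div_of_pos (by positivity), ENNReal.ofReal_one]
    exact (ENNReal.eq_div_iff (by simp; positivity) (by simp)).2 h
  · intro x (hx : 0 < x)
    simp only
    rw [gammaPDF_of_nonneg hx.le, ← ENNReal.ofReal_mul (by positivity), mul_assoc]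

theorem t1PDF_nonneg {m : ℝ} (hm : 0 < m) (x : ℝ) : 0 ≤ t1PDF m x := by
  have h1 := Real.Gamma_pos_of_pos (half_pos hm)
  have h2 := Real.Gamma_pos_of_pos (show 0 < (m + 1) / 2 by positivity)
  unfold t1PDF; positivity

theorem continuous_t1PDF {m : ℝ} (hm : 0 < m) : Continuous (t1PDF m) := by
  unfold t1PDF
  refine continuous_const.mul (Continuous.rpow_const (by fun_prop) fun x => Or.inl ?_)
  positivity

theorem integrable_t1PDF {m : ℝ} (hm : 0 < m) : Integrable (t1PDF m) := by
  have h : Integrable fun x : ℝ => (1 + ‖x‖ ^ 2) ^ (-(m + 1) / 2) :=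
    integrable_rpow_neg_one_add_norm_sq (by simp; linarith)
  have h2 := (h.comp_mul_left' (show (Real.sqrt m)⁻¹ ≠ 0 by positivity)).const_mul
    (Real.Gamma ((m + 1) / 2) / (Real.Gamma (m / 2) * Real.sqrt (m * Real.pi)))
  refine h2.congr (ae_of_all _ fun x => ?_)
  simp only [t1PDF, Real.norm_eq_abs, sq_abs, mul_pow, inv_pow, Real.sq_sqrt hm.le]
  rw [inv_mul_eq_div]

theorem ofReal_stdNormalCDF (b : ℝ) :
    ENNReal.ofReal (stdNormalCDF b) = ∫⁻ u in Set.Iic b, ENNReal.ofReal (stdNormalPDF u) :=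
  ofReal_integral_eq_lintegral_ofReal integrable_stdNormalPDF.integrableOn
    (ae_of_all _ stdNormalPDF_nonneg)

theorem ofReal_T1CDF {m : ℝ} (hm : 0 < m) (b : ℝ) :
    ENNReal.ofReal (T1CDF m b) = ∫⁻ u in Set.Iic b, ENNReal.ofReal (t1PDF m u) :=
  ofReal_integral_eq_lintegral_ofReal (integrable_t1PDF hm).integrableOn
    (ae_of_all _ (t1PDF_nonneg hm))

/-- Radial profile of the density of the standard `n`-dimensional Student `t` distribution. -/
def studentProfile (n : ℕ) (ν q : ℝ) : ℝ :=
  Real.Gamma ((ν + n) / 2) / (Real.Gamma (ν / 2) * (ν * Real.pi) ^ ((n : ℝ) / 2)) *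
    (1 + q / ν) ^ (-(ν + n) / 2)

theorem studentProfile_mul_t1PDF (n : ℕ) {ν q : ℝ} (hν : 0 < ν) (hq : 0 ≤ q) (u : ℝ) :
    studentProfile n ν q * (Real.sqrt ((ν + n) / (q + ν)) *
        t1PDF (ν + n) (Real.sqrt ((ν + n) / (q + ν)) * u)) =
      (ν / 2) ^ (ν / 2) / Real.Gamma (ν / 2) * (2 * Real.pi) ^ (-((n : ℝ) + 1) / 2) *
        (Real.Gamma ((ν + n + 1) / 2) * ((ν + q + u ^ 2) / 2) ^ (-((ν + n + 1) / 2))) := by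
  have hG := Real.Gamma_pos_of_pos (half_pos hν)
  have hn : (0 : ℝ) ≤ n := n.cast_nonneg
  have hG2 := Real.Gamma_pos_of_pos (show 0 < (ν + n) / 2 by positivity)
  have hpi := Real.pi_pos
  have e1 : 1 + q / ν = (q + ν) / ν := by field_simp; ring
  have e2 : 1 + (Real.sqrt ((ν + n) / (q + ν)) * u) ^ 2 / (ν + n) =
      (ν + q + u ^ 2) / (q + ν) := by
    rw [mul_pow, Real.sq_sqrt (by positivity)]
    have : 0 < ν + n := by positivity
    field_simp; ring
  unfold studentProfile t1PDF
  rw [e1, e2]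
  have hs : 0 < ν + q + u ^ 2 := by positivity
  have hqν : 0 < q + ν := by positivity
  have hνn : 0 < ν + n := by positivity
  have key : (ν * Real.pi) ^ (-((n : ℝ) / 2)) * ((q + ν) / ν) ^ (-(ν + n) / 2) *
      ((ν + n) / (q + ν)) ^ (1 / 2 : ℝ) * ((ν + n) * Real.pi) ^ (-(1 / 2 : ℝ)) *
      ((ν + q + u ^ 2) / (q + ν)) ^ (-(ν + n + 1) / 2) =
      (ν / 2) ^ (ν / 2) * (2 * Real.pi) ^ (-((n : ℝ) + 1) / 2) *
      ((ν + q + u ^ 2) / 2) ^ (-((ν + n + 1) / 2)) := by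
    simp only [Real.rpow_def_of_pos (show 0 < ν * Real.pi by positivity),
      Real.rpow_def_of_pos (show 0 < (q + ν) / ν by positivity),
      Real.rpow_def_of_pos (show 0 < (ν + n) / (q + ν) by positivity),
      Real.rpow_def_of_pos (show 0 < (ν + n) * Real.pi by positivity),
      Real.rpow_def_of_pos (show 0 < (ν + q + u ^ 2) / (q + ν) by positivity),
      Real.rpow_def_of_pos (show 0 < ν / 2 by positivity),
      Real.rpow_def_of_pos (show 0 < 2 * Real.pi by positivity),
      Real.rpow_def_of_pos (show 0 < (ν + q + u ^ 2) / 2 by positivity), ← Real.exp_add]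
    rw [Real.log_mul hν.ne' hpi.ne', Real.log_div hqν.ne' hν.ne', Real.log_div hνn.ne' hqν.ne',
      Real.log_mul hνn.ne' hpi.ne', Real.log_div hs.ne' hqν.ne', Real.log_div hν.ne' two_ne_zero,
      Real.log_mul two_ne_zero hpi.ne', Real.log_div hs.ne' two_ne_zero]
    congr 1
    ring
  rw [Real.rpow_neg (by positivity) ((n : ℝ) / 2), Real.rpow_neg (by positivity) (1 / 2 : ℝ),
    ← Real.sqrt_eq_rpow, ← Real.sqrt_eq_rpow] at key
  have h3 : 0 < (ν * Real.pi) ^ ((n : ℝ) / 2) := by positivity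
  have h4 : 0 < Real.sqrt ((ν + n) * Real.pi) := by positivity
  calc _ = Real.Gamma ((ν + n + 1) / 2) / Real.Gamma (ν / 2) *
        (((ν * Real.pi) ^ ((n : ℝ) / 2))⁻¹ * ((q + ν) / ν) ^ (-(ν + n) / 2) *
      Real.sqrt ((ν + n) / (q + ν)) * (Real.sqrt ((ν + n) * Real.pi))⁻¹ *
      ((ν + q + u ^ 2) / (q + ν)) ^ (-(ν + n + 1) / 2)) := by
        field_simp
    _ = _ := by rw [key]; ring

/-- A skew `t` density is a gamma mixture of dilated skew-normal densities. -/
theorem lintegral_gammaPDF_mul_skewNormal (n : ℕ) {ν q : ℝ} (hν : 0 < ν) (hq : 0 ≤ q) (b : ℝ) :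
    ∫⁻ w in Set.Ioi 0, gammaPDF (ν / 2) (ν / 2) w *
        ENNReal.ofReal (Real.sqrt w ^ n * ((2 * Real.pi) ^ (-(n : ℝ) / 2) *
          Real.exp (-(w * q) / 2) * stdNormalCDF (Real.sqrt w * b))) =
      ENNReal.ofReal (studentProfile n ν q *
        T1CDF (ν + n) (b * Real.sqrt ((ν + n) / (q + ν)))) := by
  have hG := Real.Gamma_pos_of_pos (half_pos hν)
  have hn : (0 : ℝ) ≤ n := n.cast_nonneg
  have hG2 := Real.Gamma_pos_of_pos (show 0 < (ν + n) / 2 by positivity)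
  have hpi := Real.pi_pos
  have hνn : 0 < ν + n := by positivity
  have hprof : 0 ≤ studentProfile n ν q := by unfold studentProfile; positivity
  set C := (ν / 2) ^ (ν / 2) / Real.Gamma (ν / 2) * (2 * Real.pi) ^ (-((n : ℝ) + 1) / 2) with hC
  have hC0 : 0 ≤ C := by positivity
  set a := (ν + n + 1) / 2 with ha
  have ha0 : 0 < a := by positivity
  have hL : ∀ w ∈ Set.Ioi (0 : ℝ), gammaPDF (ν / 2) (ν / 2) w *
        ENNReal.ofReal (Real.sqrt w ^ n * ((2 * Real.pi) ^ (-(n : ℝ) / 2) *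
          Real.exp (-(w * q) / 2) * stdNormalCDF (Real.sqrt w * b))) =
      ∫⁻ u in Set.Iic b, ENNReal.ofReal C * ENNReal.ofReal
        (w ^ (a - 1) * Real.exp (-((ν + q + u ^ 2) / 2 * w))) := by
    intro w (hw : 0 < w)
    have hsw : 0 < Real.sqrt w := by positivity
    rw [gammaPDF_of_nonneg hw.le, ← mul_assoc (Real.sqrt w ^ n),
      ENNReal.ofReal_mul (q := stdNormalCDF _) (by positivity), mul_comm (Real.sqrt w) b,
      ofReal_stdNormalCDF, lintegral_Iic_eq_lintegral_Iic_comp_mul hsw b (by fun_prop),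
      ← mul_assoc, ← lintegral_const_mul _ (by fun_prop)]
    refine lintegral_congr fun u => ?_
    rw [← ENNReal.ofReal_mul (by positivity), ← ENNReal.ofReal_mul (by positivity),
      ← ENNReal.ofReal_mul (by positivity), ← ENNReal.ofReal_mul (by positivity)]
    congr 1
    rw [hC, ha, stdNormalPDF]
    have e1 : w ^ ((ν + n + 1) / 2 - 1) = w ^ (ν / 2 - 1) * Real.sqrt w ^ n * Real.sqrt w := by
      rw [Real.sqrt_eq_rpow, ← Real.rpow_natCast, ← Real.rpow_mul hw.le, ← Real.rpow_add hw,
        ← Real.rpow_add hw]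
      congr 1; ring
    have e2 : (2 * Real.pi) ^ (-((n : ℝ) + 1) / 2) =
        (2 * Real.pi) ^ (-(n : ℝ) / 2) * (Real.sqrt (2 * Real.pi))⁻¹ := by
      rw [Real.sqrt_eq_rpow, ← Real.rpow_neg (by positivity), ← Real.rpow_add (by positivity)]
      congr 1; ring
    have e3 : Real.exp (-((ν + q + u ^ 2) / 2 * w)) = Real.exp (-(ν / 2 * w)) *
        Real.exp (-(w * q) / 2) * Real.exp (-(Real.sqrt w * u) ^ 2 / 2) := by
      rw [← Real.exp_add, ← Real.exp_add, mul_pow, Real.sq_sqrt hw.le]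
      congr 1; ring
    rw [e1, e2, e3]; ring
  have hR : ENNReal.ofReal (studentProfile n ν q *
        T1CDF (ν + n) (b * Real.sqrt ((ν + n) / (q + ν)))) =
      ∫⁻ u in Set.Iic b, ENNReal.ofReal C *
        ENNReal.ofReal (Real.Gamma a * ((ν + q + u ^ 2) / 2) ^ (-a)) := by
    have hm := (continuous_t1PDF hνn).measurable
    rw [ENNReal.ofReal_mul hprof, ofReal_T1CDF hνn,
      lintegral_Iic_eq_lintegral_Iic_comp_mul (by positivity) b (by fun_prop),
      ← lintegral_const_mul _ (by fun_prop)]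
    refine lintegral_congr fun u => ?_
    rw [← ENNReal.ofReal_mul (by positivity), ← ENNReal.ofReal_mul hprof,
      ← ENNReal.ofReal_mul hC0, studentProfile_mul_t1PDF n hν hq u]
  rw [setLIntegral_congr_fun measurableSet_Ioi hL, hR, lintegral_lintegral_swap (by fun_prop)]
  refine lintegral_congr fun u => ?_
  rw [lintegral_const_mul _ (by fun_prop), lintegral_rpow_mul_exp_neg_mul ha0 (by positivity)]

/-- A skew `t` law is the law of a skew-normal variate divided by the square root of an independent
gamma variate. The functions `q` and `b` play the role of the quadratic and of the linear form that
enter the skew-normal density. -/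
theorem map_inv_sqrt_smul_gammaMeasure_prod {E : Type*} [NormedAddCommGroup E] [NormedSpace ℝ E]
    [MeasurableSpace E] [BorelSpace E] [FiniteDimensional ℝ E] (μ : Measure E)
    [μ.IsAddHaarMeasure] {n : ℕ} (hn : Module.finrank ℝ E = n) {ν : ℝ} (hν : 0 < ν)
    {q b : E → ℝ} (hq : Measurable q) (hb : Measurable b) (hq0 : ∀ x, 0 ≤ q x)
    (hqs : ∀ (c : ℝ) x, q (c • x) = c ^ 2 * q x) (hbs : ∀ (c : ℝ) x, b (c • x) = c * b x)
    {K : ℝ} (hK : 0 ≤ K) :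
    Measure.map (fun p : ℝ × E => (Real.sqrt p.1)⁻¹ • p.2)
      ((gammaMeasure (ν / 2) (ν / 2)).prod (μ.withDensity fun x => ENNReal.ofReal
        (K * ((2 * Real.pi) ^ (-(n : ℝ) / 2) * Real.exp (-(q x) / 2) * stdNormalCDF (b x))))) =
      μ.withDensity fun y => ENNReal.ofReal (K * (studentProfile n ν (q y) *
        T1CDF (ν + n) (b y * Real.sqrt ((ν + n) / (q y + ν))))) := by
  set g : E → ENNReal := fun x => ENNReal.ofReal
    (K * ((2 * Real.pi) ^ (-(n : ℝ) / 2) * Real.exp (-(q x) / 2) * stdNormalCDF (b x))) with hg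
  have hgm : Measurable g := by fun_prop
  have hmg : Measurable (gammaPDF (ν / 2) (ν / 2)) := by unfold gammaPDF; fun_prop
  set G : ℝ → E → ENNReal := fun w y => gammaPDF (ν / 2) (ν / 2) w *
    (ENNReal.ofReal (Real.sqrt w ^ n) * g (Real.sqrt w • y)) with hG
  have hGm : Measurable (Function.uncurry G) := by
    simp only [hG, Function.uncurry_def]; fun_prop
  have hdens : ∀ y, ∫⁻ w in Set.Ioi 0, G w y = ENNReal.ofReal (K * (studentProfile n ν (q y) *
        T1CDF (ν + n) (b y * Real.sqrt ((ν + n) / (q y + ν))))) := by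
    intro y
    rw [ENNReal.ofReal_mul hK, ← lintegral_gammaPDF_mul_skewNormal n hν (hq0 y) (b y),
      ← lintegral_const_mul _ (by fun_prop)]
    refine setLIntegral_congr_fun measurableSet_Ioi fun w (hw : 0 < w) => ?_
    simp only [hG, hg, hqs, hbs, Real.sq_sqrt hw.le]
    rw [← ENNReal.ofReal_mul (by positivity), mul_left_comm, ENNReal.ofReal_mul hK]
    ring
  simp_rw [← hdens]
  refine Measure.ext_of_lintegral _ fun f hf => ?_
  rw [lintegral_map hf (by fun_prop), lintegral_prod _ (by fun_prop), gammaMeasure,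
    lintegral_withDensity_eq_lintegral_mul _ hmg (by fun_prop),
    lintegral_withDensity_eq_lintegral_mul _ _ hf]
  swap
  · exact Measurable.lintegral_prod_left hGm
  have h0 : ∀ F : ℝ → ENNReal, ∫⁻ w, (gammaPDF (ν / 2) (ν / 2) * F) w =
      ∫⁻ w in Set.Ioi 0, gammaPDF (ν / 2) (ν / 2) w * F w := by
    intro F
    rw [← lintegral_indicator measurableSet_Ioi]
    refine lintegral_congr_ae ?_
    filter_upwards [compl_mem_ae_iff.2 (measure_singleton (μ := volume) (0 : ℝ))] with w hw
    rcases lt_trichotomy w 0 with h | h | h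
    · simp [gammaPDF_of_neg h, not_lt.2 h.le]
    · exact absurd h hw
    · simp [h]
  rw [h0]
  simp only [Pi.mul_apply]
  have h1 : ∀ w ∈ Set.Ioi (0 : ℝ), gammaPDF (ν / 2) (ν / 2) w *
      ∫⁻ x, f ((Real.sqrt w)⁻¹ • x) ∂(μ.withDensity g) = ∫⁻ y, G w y * f y ∂μ := by
    intro w (hw : 0 < w)
    have hsw : 0 < Real.sqrt w := by positivity
    rw [lintegral_withDensity_eq_lintegral_mul _ hgm (by fun_prop),
      lintegral_eq_mul_lintegral_comp_smul μ hn hsw (by fun_prop),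
      ← lintegral_const_mul _ (by fun_prop)]
    refine lintegral_congr fun y => ?_
    simp only [hG, Pi.mul_apply, smul_smul, inv_mul_cancel₀ hsw.ne', one_smul]
    ring
  rw [setLIntegral_congr_fun measurableSet_Ioi h1, lintegral_lintegral_swap (by
    simp only [Function.uncurry_def] at hGm ⊢; fun_prop)]
  refine lintegral_congr fun y => ?_
  rw [lintegral_mul_const]
  exact hGm.comp measurable_prodMk_right

/-- The univariate skew-normal law `SN₁(0, 1, β)`. -/
def skewNormalMeasure (β : ℝ) : Measure ℝ :=
  volume.withDensity fun x => ENNReal.ofReal (sn1PDF β x)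

theorem continuous_sn1PDF (β : ℝ) : Continuous (sn1PDF β) := by
  unfold sn1PDF; fun_prop

theorem sn1PDF_nonneg (β x : ℝ) : 0 ≤ sn1PDF β x :=
  mul_nonneg (mul_nonneg zero_le_two (stdNormalPDF_nonneg x)) (stdNormalCDF_nonneg _)

theorem stdNormalPDF_eq_rpow (x : ℝ) :
    stdNormalPDF x = (2 * Real.pi) ^ (-(1 : ℝ) / 2) * Real.exp (-x ^ 2 / 2) := by
  rw [stdNormalPDF, Real.sqrt_eq_rpow, ← Real.rpow_neg (by positivity), neg_div (2 : ℝ) 1]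

theorem withDensity_st1PDF (β : ℝ) {ν : ℝ} (hν : 0 < ν) :
    (volume.withDensity fun x => ENNReal.ofReal (st1PDF β ν x)) =
      Measure.map (fun p : ℝ × ℝ => (Real.sqrt p.1)⁻¹ * p.2)
        ((gammaMeasure (ν / 2) (ν / 2)).prod (skewNormalMeasure β)) := by
  have h := map_inv_sqrt_smul_gammaMeasure_prod (volume : Measure ℝ) (Module.finrank_self ℝ) hν
    (q := fun x => x ^ 2) (b := fun x => β * x) (by fun_prop) (by fun_prop)
    (fun x => sq_nonneg x) (fun c x => by simp; ring) (fun c x => by simp; ring) zero_le_two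
  simp only [smul_eq_mul, Nat.cast_one] at h
  have h1 : ∀ x, 2 * (studentProfile 1 ν (x ^ 2) *
      T1CDF (ν + 1) (β * x * Real.sqrt ((ν + 1) / (x ^ 2 + ν)))) = st1PDF β ν x := by
    intro x
    have hs : studentProfile 1 ν (x ^ 2) = t1PDF ν x := by
      rw [studentProfile, t1PDF, Real.sqrt_eq_rpow]
      simp
    rw [st1PDF, hs, ← mul_assoc]
  have h2 : ∀ x, 2 * ((2 * Real.pi) ^ (-(1 : ℝ) / 2) * Real.exp (-x ^ 2 / 2) *
      stdNormalCDF (β * x)) = sn1PDF β x := by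
    intro x
    rw [sn1PDF, stdNormalPDF_eq_rpow, mul_assoc 2]
  simp only [h1, h2] at h
  exact h.symm

theorem pi_withDensity_ofReal {ι : Type*} [Fintype ι] (f : ℝ → ℝ) (hf : Integrable f)
    (hf0 : ∀ x, 0 ≤ f x) :
    Measure.pi (fun _ : ι => volume.withDensity fun x => ENNReal.ofReal (f x)) =
      volume.withDensity fun x : ι → ℝ => ENNReal.ofReal (∏ i, f (x i)) := by
  have : SigmaFinite (volume.withDensity fun x => ENNReal.ofReal (f x)) :=
    SigmaFinite.withDensity_ofReal _
  refine Measure.pi_eq fun s hs => ?_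
  have hi : ∀ i, Integrable ((s i).indicator f) := fun i => hf.indicator (hs i)
  have h0 : ∀ i x, 0 ≤ (s i).indicator f x := fun i => Set.indicator_nonneg fun x _ => hf0 x
  rw [withDensity_apply _ (MeasurableSet.univ_pi hs),
    ← lintegral_indicator (MeasurableSet.univ_pi hs)]
  have h1 : ∀ x : ι → ℝ, (Set.univ.pi s).indicator (fun x => ENNReal.ofReal (∏ i, f (x i))) x =
      ENNReal.ofReal (∏ i, (s i).indicator f (x i)) := by
    intro x
    by_cases hx : x ∈ Set.univ.pi s
    · rw [Set.indicator_of_mem hx]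
      congr 1
      exact Finset.prod_congr rfl fun i _ => (Set.indicator_of_mem (hx i trivial) f).symm
    · rw [Set.indicator_of_notMem hx]
      simp only [Set.mem_univ_pi, not_forall] at hx
      obtain ⟨i, hi⟩ := hx
      rw [Finset.prod_eq_zero (Finset.mem_univ i) (Set.indicator_of_notMem hi f),
        ENNReal.ofReal_zero]
  have hI : Integrable (fun x : ι → ℝ => ∏ i, (s i).indicator f (x i)) :=
    Integrable.fintype_prod hi
  rw [lintegral_congr h1, ← ofReal_integral_eq_lintegral_ofReal hI
    (ae_of_all _ fun x => Finset.prod_nonneg fun i _ => h0 i _),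
    integral_fintype_prod_volume_eq_prod fun i => (s i).indicator f,
    ENNReal.ofReal_prod_of_nonneg fun i _ => integral_nonneg (h0 i)]
  refine Finset.prod_congr rfl fun i _ => ?_
  rw [withDensity_apply _ (hs i), ofReal_integral_eq_lintegral_ofReal (hi i) (ae_of_all _ (h0 i)),
    ← lintegral_indicator (hs i)]
  refine lintegral_congr fun x => ?_
  by_cases hx : x ∈ s i <;> simp [hx]

/-- The standard normal law on `Fin n → ℝ`. -/
abbrev stdNormalPi (n : ℕ) : Measure (Fin n → ℝ) := Measure.pi fun _ => gaussianReal 0 1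

theorem stdNormalPi_eq_withDensity (n : ℕ) :
    stdNormalPi n = volume.withDensity fun x =>
      ENNReal.ofReal ((2 * Real.pi) ^ (-(n : ℝ) / 2) * Real.exp (-(∑ i, x i ^ 2) / 2)) := by
  have hg : gaussianReal 0 1 = volume.withDensity fun x => ENNReal.ofReal (stdNormalPDF x) := by
    rw [gaussianReal_of_var_ne_zero _ one_ne_zero, stdNormalPDF_eq_gaussianPDFReal]; rfl
  rw [stdNormalPi, hg, pi_withDensity_ofReal _ integrable_stdNormalPDF stdNormalPDF_nonneg]
  congr! 3 with x
  simp only [stdNormalPDF_eq_rpow, Finset.prod_mul_distrib, Finset.prod_const, Finset.card_univ,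
    Fintype.card_fin, ← Real.exp_sum, ← Finset.sum_neg_distrib, Finset.sum_div]
  rw [← Real.rpow_natCast, ← Real.rpow_mul (by positivity)]
  congr 2; ring

theorem piFinSuccAbove_zero_symm_apply (n : ℕ) (p : ℝ × (Fin n → ℝ)) :
    (MeasurableEquiv.piFinSuccAbove (fun _ : Fin (n + 1) => ℝ) 0).symm p = Fin.cons p.1 p.2 := by
  simp [MeasurableEquiv.piFinSuccAbove_symm_apply, Fin.insertNthEquiv]

theorem measurable_finCons (n : ℕ) :
    Measurable fun p : ℝ × (Fin n → ℝ) => (Fin.cons p.1 p.2 : Fin (n + 1) → ℝ) := by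
  simp_rw [← piFinSuccAbove_zero_symm_apply]
  exact MeasurableEquiv.measurable _

/-- Affine images of the canonical skew-normal law. -/
theorem map_mulVec_cons_skewNormalMeasure_prod (β : ℝ) {n : ℕ}
    {A : Matrix (Fin (n + 1)) (Fin (n + 1)) ℝ} (hA : A.det ≠ 0) :
    Measure.map (fun p : ℝ × (Fin n → ℝ) => A *ᵥ (Fin.cons p.1 p.2 : Fin (n + 1) → ℝ))
        ((skewNormalMeasure β).prod (stdNormalPi n)) =
      volume.withDensity fun y => ENNReal.ofReal (2 * |A.det|⁻¹ *
        ((2 * Real.pi) ^ (-((n + 1 : ℕ) : ℝ) / 2) * Real.exp (-(∑ i, (A⁻¹ *ᵥ y) i ^ 2) / 2) *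
          stdNormalCDF (β * (A⁻¹ *ᵥ y) 0))) := by
  have hs := continuous_sn1PDF β
  have hcons : Measurable fun p : ℝ × (Fin n → ℝ) => (Fin.cons p.1 p.2 : Fin (n + 1) → ℝ) :=
    measurable_finCons n
  have hAm : Measurable fun x : Fin (n + 1) → ℝ => A *ᵥ x := by fun_prop
  have hAi : Measurable fun x : Fin (n + 1) → ℝ => A⁻¹ *ᵥ x := by fun_prop
  rw [skewNormalMeasure, stdNormalPi_eq_withDensity,
    prod_withDensity (by fun_prop) (by fun_prop)]
  refine Measure.ext_of_lintegral _ fun f hf => ?_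
  rw [lintegral_map hf (by fun_prop), lintegral_withDensity_eq_lintegral_mul _ (by fun_prop)
    (by fun_prop), lintegral_withDensity_eq_lintegral_mul _ (by fun_prop) hf]
  set D : (Fin (n + 1) → ℝ) → ℝ := fun x =>
    2 * ((2 * Real.pi) ^ (-((n + 1 : ℕ) : ℝ) / 2) * Real.exp (-(∑ i, x i ^ 2) / 2) *
      stdNormalCDF (β * x 0)) with hD
  have hDm : Measurable D := by fun_prop
  have h1 : ∫⁻ y, ENNReal.ofReal (D (A⁻¹ *ᵥ y)) * f y =
      ENNReal.ofReal |A.det| * ∫⁻ x, ENNReal.ofReal (D x) * f (A *ᵥ x) := by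
    have h := lintegral_map (μ := volume) (f := fun y => ENNReal.ofReal (D (A⁻¹ *ᵥ y)) * f y)
      (by fun_prop) hAm
    have h2 := Real.map_matrix_volume_pi_eq_smul_volume_pi hA
    rw [show ⇑(toLin' A) = fun x => A *ᵥ x from rfl] at h2
    rw [h2, lintegral_smul_measure, smul_eq_mul] at h
    simp only [mulVec_mulVec, nonsing_inv_mul A (isUnit_iff_ne_zero.2 hA), one_mulVec] at h
    rw [← h, ← mul_assoc, ← ENNReal.ofReal_mul (abs_nonneg _), ← abs_mul, mul_inv_cancel₀ hA,
      abs_one, ENNReal.ofReal_one, one_mul]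
  have h2 : ∫⁻ x, ENNReal.ofReal (D x) * f (A *ᵥ x) = ∫⁻ p : ℝ × (Fin n → ℝ),
      ENNReal.ofReal (D (Fin.cons p.1 p.2)) * f (A *ᵥ (Fin.cons p.1 p.2 : Fin (n + 1) → ℝ)) := by
    rw [← (volume_preserving_piFinSuccAbove (fun _ : Fin (n + 1) => ℝ) 0).symm.lintegral_comp
      (by fun_prop)]
    simp_rw [piFinSuccAbove_zero_symm_apply]
  have h3 : ∀ y, ENNReal.ofReal (2 * |A.det|⁻¹ *
        ((2 * Real.pi) ^ (-((n + 1 : ℕ) : ℝ) / 2) * Real.exp (-(∑ i, (A⁻¹ *ᵥ y) i ^ 2) / 2) *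
          stdNormalCDF (β * (A⁻¹ *ᵥ y) 0))) * f y =
      ENNReal.ofReal |A.det|⁻¹ * (ENNReal.ofReal (D (A⁻¹ *ᵥ y)) * f y) := by
    intro y
    rw [← mul_assoc (ENNReal.ofReal _), ← ENNReal.ofReal_mul (by positivity)]
    congr 2
    simp only [hD]; ring
  simp only [Pi.mul_apply, h3]
  rw [lintegral_const_mul _ (by fun_prop), h1, h2, ← mul_assoc,
    ← ENNReal.ofReal_mul (by positivity), inv_mul_cancel₀ (by positivity), ENNReal.ofReal_one,
    one_mul, Measure.volume_eq_prod]
  refine lintegral_congr fun p => ?_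
  rw [← ENNReal.ofReal_mul (sn1PDF_nonneg _ _)]
  congr 2
  simp only [hD, sn1PDF, stdNormalPDF_eq_rpow, Fin.sum_univ_succ, Fin.cons_zero, Fin.cons_succ]
  have e1 : (2 * Real.pi) ^ (-((n + 1 : ℕ) : ℝ) / 2) =
      (2 * Real.pi) ^ (-(1 : ℝ) / 2) * (2 * Real.pi) ^ (-(n : ℝ) / 2) := by
    rw [← Real.rpow_add (by positivity)]
    congr 1; push_cast; ring
  have e2 : Real.exp (-(p.1 ^ 2 + ∑ i, p.2 i ^ 2) / 2) =
      Real.exp (-p.1 ^ 2 / 2) * Real.exp (-(∑ i, p.2 i ^ 2) / 2) := by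
    rw [← Real.exp_add]; congr 1; ring
  rw [e1, e2]; ring

instance (β : ℝ) : SFinite (skewNormalMeasure β) := by
  unfold skewNormalMeasure; infer_instance

theorem exists_orthonormalBasis_eq_norm_smul {n : ℕ} (v : EuclideanSpace ℝ (Fin (n + 1))) :
    ∃ b : OrthonormalBasis (Fin (n + 1)) ℝ (EuclideanSpace ℝ (Fin (n + 1))), v = ‖v‖ • b 0 := by
  by_cases hv : v = 0
  · exact ⟨EuclideanSpace.basisFun _ _, by simp [hv]⟩
  have hv' : ‖v‖ ≠ 0 := norm_ne_zero_iff.2 hv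
  obtain ⟨b, hb⟩ := Orthonormal.exists_orthonormalBasis_extension_of_card_eq (𝕜 := ℝ)
    (E := EuclideanSpace ℝ (Fin (n + 1))) (ι := Fin (n + 1)) (by simp)
    (v := fun _ => ‖v‖⁻¹ • v) (s := {0}) (by
      refine ⟨fun i => ?_, fun i j hij => absurd (Subsingleton.elim i j) hij⟩
      simp [Set.domRestrict, norm_smul, hv'])
  refine ⟨b, ?_⟩
  rw [hb 0 rfl, smul_smul, mul_inv_cancel₀ hv', one_smul]

open scoped MatrixOrder Matrix.Norms.L2Operator in
theorem Matrix.PosSemidef.exists_eq_transpose_mul_self {ι : Type*} [Fintype ι] [DecidableEq ι]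
    {S : Matrix ι ι ℝ} (hS : S.PosSemidef) : ∃ B : Matrix ι ι ℝ, S = Bᵀ * B := by
  obtain ⟨B, hB⟩ := CStarAlgebra.nonneg_iff_eq_star_mul_self.mp hS.nonneg
  exact ⟨B, by rw [hB, star_eq_conjTranspose, conjTranspose_eq_transpose_of_trivial]⟩

/-- A positive definite matrix has a square root that maps the first basis vector to the direction
that represents a given linear form. -/
theorem Matrix.PosDef.exists_mul_transpose_eq_and_mulVec_eq_single {n : ℕ}
    {S : Matrix (Fin (n + 1)) (Fin (n + 1)) ℝ} (hS : S.PosDef) (c : Fin (n + 1) → ℝ) :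
    ∃ A : Matrix (Fin (n + 1)) (Fin (n + 1)) ℝ, A.det ≠ 0 ∧ A * Aᵀ = S ∧
      Aᵀ *ᵥ c = Pi.single 0 (Real.sqrt (c ⬝ᵥ (S *ᵥ c))) := by
  obtain ⟨B, hB⟩ := hS.posSemidef.exists_eq_transpose_mul_self
  obtain ⟨b, hb⟩ := exists_orthonormalBasis_eq_norm_smul (WithLp.toLp 2 (B *ᵥ c))
  set r := ‖WithLp.toLp 2 (B *ᵥ c)‖ with hr
  have hr2 : r = Real.sqrt (c ⬝ᵥ (S *ᵥ c)) := by
    rw [hr, EuclideanSpace.norm_eq, hB, ← mulVec_mulVec, dotProduct_mulVec, vecMul_transpose]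
    simp [dotProduct, sq]
  set R : Matrix (Fin (n + 1)) (Fin (n + 1)) ℝ := Matrix.of fun i j => b j i with hR
  have hRR : Rᵀ * R = 1 := by
    ext i j
    rw [one_apply, ← orthonormal_iff_ite.1 b.orthonormal i j]
    simp [hR, mul_apply, PiLp.inner_apply, mul_comm]
  have hRR' : R * Rᵀ = 1 := mul_eq_one_comm.1 hRR
  have hAA : (Bᵀ * R) * (Bᵀ * R)ᵀ = S := by
    rw [transpose_mul, transpose_transpose, Matrix.mul_assoc, ← Matrix.mul_assoc R, hRR',
      Matrix.one_mul, hB]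
  refine ⟨Bᵀ * R, fun h => hS.det_pos.ne' ?_, hAA, ?_⟩
  · rw [← hAA, det_mul, h, zero_mul]
  · have hv : B *ᵥ c = R *ᵥ Pi.single 0 r := by
      ext i
      have := congrArg (fun x : EuclideanSpace ℝ (Fin (n + 1)) => x i) hb
      simpa [hR, mul_comm] using this
    rw [transpose_mul, transpose_transpose, ← mulVec_mulVec, hv, mulVec_mulVec, hRR, one_mulVec,
      hr2]

theorem stPDF_eq_stPDF_zero_sub {d : ℕ} (ξ : Fin d → ℝ) (S : Matrix (Fin d) (Fin d) ℝ)
    (α : Fin d → ℝ) (ν : ℝ) (y : Fin d → ℝ) : stPDF ξ S α ν y = stPDF 0 S α ν (y - ξ) := by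
  simp [stPDF]

/-- The stochastic representation of the centered skew `t` law in terms of independent variates. -/
theorem withDensity_stPDF_zero {n : ℕ} {A : Matrix (Fin (n + 1)) (Fin (n + 1)) ℝ} (hA : A.det ≠ 0)
    (α : Fin (n + 1) → ℝ) {β : ℝ}
    (hβ : Aᵀ *ᵥ ((scaleMat (A * Aᵀ))⁻¹ *ᵥ α) = Pi.single 0 β) {ν : ℝ} (hν : 0 < ν) :
    (volume.withDensity fun y => ENNReal.ofReal (stPDF 0 (A * Aᵀ) α ν y)) =
      Measure.map (fun p : ℝ × ℝ × (Fin n → ℝ) =>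
          (Real.sqrt p.1)⁻¹ • (A *ᵥ (Fin.cons p.2.1 p.2.2 : Fin (n + 1) → ℝ)))
        ((gammaMeasure (ν / 2) (ν / 2)).prod ((skewNormalMeasure β).prod (stdNormalPi n))) := by
  have hAu : IsUnit A.det := isUnit_iff_ne_zero.2 hA
  have hq : ∀ y, y ⬝ᵥ ((A * Aᵀ)⁻¹ *ᵥ y) = ∑ i, (A⁻¹ *ᵥ y) i ^ 2 := by
    intro y
    rw [Matrix.mul_inv_rev, ← transpose_nonsing_inv, ← mulVec_mulVec, dotProduct_mulVec,
      vecMul_transpose]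
    simp [dotProduct, sq]
  have hb : ∀ y, α ⬝ᵥ ((scaleMat (A * Aᵀ))⁻¹ *ᵥ y) = β * (A⁻¹ *ᵥ y) 0 := by
    intro y
    have hsym : ((scaleMat (A * Aᵀ))⁻¹)ᵀ = (scaleMat (A * Aᵀ))⁻¹ := by
      rw [transpose_nonsing_inv, scaleMat, diagonal_transpose]
    have hy : y = A *ᵥ (A⁻¹ *ᵥ y) := by
      rw [mulVec_mulVec, mul_nonsing_inv A hAu, one_mulVec]
    conv_lhs => rw [hy]
    rw [dotProduct_mulVec, ← mulVec_transpose, hsym, dotProduct_mulVec, ← mulVec_transpose, hβ,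
      single_dotProduct]
  have h := map_inv_sqrt_smul_gammaMeasure_prod (volume : Measure (Fin (n + 1) → ℝ))
    (n := n + 1) (by simp) hν (q := fun y => ∑ i, (A⁻¹ *ᵥ y) i ^ 2)
    (b := fun y => β * (A⁻¹ *ᵥ y) 0) (by fun_prop) (by fun_prop)
    (fun y => Finset.sum_nonneg fun i _ => sq_nonneg _)
    (fun c y => by simp [mulVec_smul, mul_pow, Finset.mul_sum])
    (fun c y => by simp [mulVec_smul]; ring)
    (K := 2 * |A.det|⁻¹) (by positivity)
  rw [← map_mulVec_cons_skewNormalMeasure_prod β hA] at h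
  have := isProbabilityMeasure_gammaMeasure (half_pos hν) (half_pos hν)
  have hmp := Measure.map_prod_map (gammaMeasure (ν / 2) (ν / 2))
    ((skewNormalMeasure β).prod (stdNormalPi n)) measurable_id
    (show Measurable fun p : ℝ × (Fin n → ℝ) => A *ᵥ (Fin.cons p.1 p.2 : Fin (n + 1) → ℝ) by
      have := measurable_finCons n
      fun_prop)
  rw [Measure.map_id] at hmp
  rw [hmp, Measure.map_map (by fun_prop) (by
    have := measurable_finCons n
    fun_prop)] at h
  have hfun : (fun y => ENNReal.ofReal (stPDF 0 (A * Aᵀ) α ν y)) = fun y =>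
      ENNReal.ofReal (2 * |A.det|⁻¹ * (studentProfile (n + 1) ν (∑ i, (A⁻¹ *ᵥ y) i ^ 2) *
        T1CDF (ν + (n + 1 : ℕ)) (β * (A⁻¹ *ᵥ y) 0 *
          Real.sqrt ((ν + (n + 1 : ℕ)) / (∑ i, (A⁻¹ *ᵥ y) i ^ 2 + ν))))) := by
    ext y
    have hdet : Real.sqrt (A * Aᵀ).det = |A.det| := by
      rw [det_mul, det_transpose, Real.sqrt_mul_self_eq_abs]
    congr 1
    rw [stPDF, tdPDF, studentProfile, sub_zero, hq, hb, hdet]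
    ring
  rw [hfun, ← h]
  rfl

theorem integrable_pow_mul_stdNormalPDF (k : ℕ) : Integrable fun x => x ^ k * stdNormalPDF x := by
  have h := (integrable_rpow_mul_exp_neg_mul_sq (b := 1 / 2) (by norm_num) (s := k)
    (by linarith [k.cast_nonneg (α := ℝ)])).const_mul (Real.sqrt (2 * Real.pi))⁻¹
  refine h.congr (ae_of_all _ fun x => ?_)
  simp only [stdNormalPDF, Real.rpow_natCast]
  rw [show -(1 / 2) * x ^ 2 = -x ^ 2 / 2 by ring]
  ring

theorem hasDerivAt_stdNormalPDF (x : ℝ) : HasDerivAt stdNormalPDF (-(x * stdNormalPDF x)) x := by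
  have h := ((((hasDerivAt_pow 2 x).neg).div_const 2).exp).const_mul (Real.sqrt (2 * Real.pi))⁻¹
  refine h.congr_deriv ?_
  simp [stdNormalPDF]
  ring

/-- Stein's identity. -/
theorem integral_mul_self_mul_stdNormalPDF {u u' : ℝ → ℝ} (hu : ∀ x, HasDerivAt u (u' x) x)
    (h1 : Integrable fun x => u x * (x * stdNormalPDF x))
    (h2 : Integrable fun x => u' x * stdNormalPDF x)
    (h3 : Integrable fun x => u x * stdNormalPDF x) :
    ∫ x, u x * (x * stdNormalPDF x) = ∫ x, u' x * stdNormalPDF x := by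
  have h := integral_mul_deriv_eq_deriv_mul_of_integrable (u := u) (v := stdNormalPDF)
    (u' := u') (v' := fun x => -(x * stdNormalPDF x))
    (fun x _ => hu x) (fun x _ => hasDerivAt_stdNormalPDF x)
    (by simpa [Pi.mul_def] using h1.neg) h2 h3
  simpa [integral_neg] using h

theorem integral_pow_add_two_mul_stdNormalPDF (k : ℕ) :
    ∫ x, x ^ (k + 2) * stdNormalPDF x = (k + 1) * ∫ x, x ^ k * stdNormalPDF x := by
  have h := integral_mul_self_mul_stdNormalPDF (u := fun x => x ^ (k + 1))
    (fun x => hasDerivAt_pow (k + 1) x)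
    ((integrable_pow_mul_stdNormalPDF (k + 2)).congr (ae_of_all _ fun x => by ring))
    (((integrable_pow_mul_stdNormalPDF k).const_mul (k + 1 : ℝ)).congr
      (ae_of_all _ fun x => by simp; ring))
    (integrable_pow_mul_stdNormalPDF (k + 1))
  rw [← integral_const_mul]
  refine Eq.trans (integral_congr_ae (ae_of_all _ fun x => ?_))
    (h.trans (integral_congr_ae (ae_of_all _ fun x => ?_)))
  · simp only; ring
  · simp; ring

theorem integral_sq_mul_stdNormalPDF : ∫ x, x ^ 2 * stdNormalPDF x = 1 := by
  have := integral_pow_add_two_mul_stdNormalPDF 0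
  simpa [integral_stdNormalPDF] using this

theorem integral_pow_four_mul_stdNormalPDF : ∫ x, x ^ 4 * stdNormalPDF x = 3 := by
  have := integral_pow_add_two_mul_stdNormalPDF 2
  rw [integral_sq_mul_stdNormalPDF] at this
  norm_num at this
  exact this

theorem integral_skewNormalMeasure (β : ℝ) (f : ℝ → ℝ) :
    ∫ x, f x ∂skewNormalMeasure β = ∫ x, f x * sn1PDF β x := by
  have := continuous_sn1PDF β
  rw [skewNormalMeasure, integral_withDensity_eq_integral_toReal_smul (by fun_prop) (by simp)]
  refine integral_congr_ae (ae_of_all _ fun x => ?_)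
  simp [ENNReal.toReal_ofReal (sn1PDF_nonneg β x), mul_comm]

theorem integrable_mul_sn1PDF (β : ℝ) {f : ℝ → ℝ}
    (hi : Integrable fun x => f x * stdNormalPDF x) : Integrable fun x => f x * sn1PDF β x := by
  have h := hi.mul_bdd (c := 2) (g := fun x => 2 * stdNormalCDF (β * x))
    (Measurable.aestronglyMeasurable (by fun_prop)) (ae_of_all _ fun x => by
      rw [Real.norm_of_nonneg (mul_nonneg zero_le_two (stdNormalCDF_nonneg _))]
      linarith [stdNormalCDF_le_one (β * x)])
  refine h.congr (ae_of_all _ fun x => ?_)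
  simp only [sn1PDF]
  ring

theorem integrable_skewNormalMeasure (β : ℝ) {f : ℝ → ℝ}
    (hi : Integrable fun x => f x * stdNormalPDF x) : Integrable f (skewNormalMeasure β) := by
  have := continuous_sn1PDF β
  rw [skewNormalMeasure, integrable_withDensity_iff_integrable_smul' (by fun_prop) (by simp)]
  refine (integrable_mul_sn1PDF β hi).congr (ae_of_all _ fun x => ?_)
  simp [ENNReal.toReal_ofReal (sn1PDF_nonneg β x), mul_comm]

theorem integral_skewNormalMeasure_of_even (β : ℝ) {f : ℝ → ℝ} (hf : ∀ x, f (-x) = f x)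
    (hi : Integrable fun x => f x * stdNormalPDF x) :
    ∫ x, f x ∂skewNormalMeasure β = ∫ x, f x * stdNormalPDF x := by
  have h2 := integrable_mul_sn1PDF β hi
  have h3 : ∫ x, f x * sn1PDF β x = ∫ x, f (-x) * sn1PDF β (-x) :=
    (integral_neg_eq_self (fun x => f x * sn1PDF β x) volume).symm
  have h4 : ∫ x, (f x * sn1PDF β x + f (-x) * sn1PDF β (-x)) =
      2 * ∫ x, f x * stdNormalPDF x := by
    rw [← integral_const_mul]
    refine integral_congr_ae (ae_of_all _ fun x => ?_)
    have := stdNormalCDF_add_neg (β * x)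
    have hp : stdNormalPDF (-x) = stdNormalPDF x := by simp [stdNormalPDF]
    simp only [hf, sn1PDF, hp, mul_neg]
    linear_combination 2 * f x * stdNormalPDF x * this
  rw [integral_add h2 h2.comp_neg, ← h3] at h4
  rw [integral_skewNormalMeasure]
  linarith

instance (β : ℝ) : IsProbabilityMeasure (skewNormalMeasure β) := by
  have := continuous_sn1PDF β
  refine ⟨?_⟩
  have h1 := integral_skewNormalMeasure_of_even β (f := fun _ => 1) (fun _ => rfl)
    (by simpa using integrable_stdNormalPDF)
  rw [integral_skewNormalMeasure] at h1
  have h2 := integrable_mul_sn1PDF β (f := fun _ => 1) (by simpa using integrable_stdNormalPDF)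
  simp only [one_mul, integral_stdNormalPDF] at h1 h2
  rw [skewNormalMeasure, withDensity_apply _ MeasurableSet.univ, Measure.restrict_univ,
    ← ofReal_integral_eq_lintegral_ofReal h2 (ae_of_all _ (sn1PDF_nonneg β)), h1,
    ENNReal.ofReal_one]

theorem integrable_pow_skewNormalMeasure (β : ℝ) (k : ℕ) :
    Integrable (fun x => x ^ k) (skewNormalMeasure β) :=
  integrable_skewNormalMeasure β (integrable_pow_mul_stdNormalPDF k)

theorem integral_sq_skewNormalMeasure (β : ℝ) : ∫ x, x ^ 2 ∂skewNormalMeasure β = 1 := by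
  rw [integral_skewNormalMeasure_of_even β (fun x => by ring) (integrable_pow_mul_stdNormalPDF 2),
    integral_sq_mul_stdNormalPDF]

theorem integral_pow_four_skewNormalMeasure (β : ℝ) : ∫ x, x ^ 4 ∂skewNormalMeasure β = 3 := by
  rw [integral_skewNormalMeasure_of_even β (fun x => by ring) (integrable_pow_mul_stdNormalPDF 4),
    integral_pow_four_mul_stdNormalPDF]

theorem integral_id_skewNormalMeasure (β : ℝ) :
    ∫ x, x ∂skewNormalMeasure β = Real.sqrt (2 / Real.pi) * (β / Real.sqrt (1 + β ^ 2)) := by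
  have hp : ∀ x, stdNormalPDF (β * x) * stdNormalPDF x =
      (2 * Real.pi)⁻¹ * Real.exp (-((1 + β ^ 2) / 2) * x ^ 2) := by
    intro x
    rw [stdNormalPDF, stdNormalPDF, mul_mul_mul_comm, ← Real.exp_add, ← mul_inv,
      Real.mul_self_sqrt (by positivity)]
    ring_nf
  have hd : ∀ x, HasDerivAt (fun x => 2 * stdNormalCDF (β * x)) (2 * (stdNormalPDF (β * x) * β)) x :=
    fun x => ((hasDerivAt_stdNormalCDF (β * x)).comp x
      (by simpa using (hasDerivAt_id x).const_mul β)).const_mul 2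
  have h := integral_mul_self_mul_stdNormalPDF hd
    ((integrable_mul_sn1PDF β (f := fun x => x)
      (by simpa using integrable_pow_mul_stdNormalPDF 1)).congr
        (ae_of_all _ fun x => by simp only [sn1PDF]; ring))
    (((integrable_exp_neg_mul_sq (b := (1 + β ^ 2) / 2) (by positivity)).const_mul
      (2 * β * (2 * Real.pi)⁻¹)).congr
      (ae_of_all _ fun x => by simp only; linear_combination -2 * β * hp x))
    ((integrable_mul_sn1PDF β (f := fun _ => 1) (by simpa using integrable_stdNormalPDF)).congr
      (ae_of_all _ fun x => by simp only [sn1PDF]; ring))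
  rw [integral_skewNormalMeasure]
  have h1 : ∫ x, x * sn1PDF β x = 2 * β * (2 * Real.pi)⁻¹ * Real.sqrt (Real.pi / ((1 + β ^ 2) / 2)) := by
    rw [← integral_gaussian, ← integral_const_mul]
    refine Eq.trans (integral_congr_ae (ae_of_all _ fun x => ?_))
      (h.trans (integral_congr_ae (ae_of_all _ fun x => ?_)))
    · simp only [sn1PDF]; ring
    · simp only; linear_combination 2 * β * hp x
  have hpi := Real.pi_pos
  rw [h1, show Real.pi / ((1 + β ^ 2) / 2) = (2 / Real.pi) * (Real.pi ^ 2 / (1 + β ^ 2)) by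
    field_simp, Real.sqrt_mul (by positivity), Real.sqrt_div (by positivity) (1 + β ^ 2),
    Real.sqrt_sq (by positivity)]
  field_simp

theorem integrable_pow_gaussianReal (k : ℕ) : Integrable (fun x => x ^ k) (gaussianReal 0 1) := by
  rw [gaussianReal_of_var_ne_zero _ one_ne_zero,
    integrable_withDensity_iff_integrable_smul' (measurable_gaussianPDF 0 1)
      (ae_of_all _ fun _ => gaussianPDF_lt_top)]
  refine (integrable_pow_mul_stdNormalPDF k).congr (ae_of_all _ fun x => ?_)
  simp [stdNormalPDF_eq_gaussianPDFReal, mul_comm]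

theorem integral_gaussianReal_zero_one (f : ℝ → ℝ) :
    ∫ x, f x ∂gaussianReal 0 1 = ∫ x, f x * stdNormalPDF x := by
  rw [integral_gaussianReal_eq_integral_smul one_ne_zero]
  simp [stdNormalPDF_eq_gaussianPDFReal, mul_comm]

section StdNormalPi

variable {n : ℕ}

theorem integral_eval_stdNormalPi (i : Fin n) : ∫ x, x i ∂stdNormalPi n = 0 := by
  rw [integral_eval, integral_id_gaussianReal]

theorem integrable_eval_stdNormalPi (i : Fin n) : Integrable (fun x => x i) (stdNormalPi n) :=
  integrable_eval ((integrable_pow_gaussianReal 1).congr (ae_of_all _ fun x => pow_one x))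

theorem memLp_sq_gaussianReal : MemLp (fun x : ℝ => x ^ 2) 2 (gaussianReal 0 1) := by
  rw [memLp_two_iff_integrable_sq (by fun_prop)]
  simpa [← pow_mul] using integrable_pow_gaussianReal 4

theorem variance_sq_gaussianReal : Var[fun x : ℝ => x ^ 2; gaussianReal 0 1] = 2 := by
  rw [variance_eq_sub memLp_sq_gaussianReal]
  simp only [Pi.pow_apply, ← pow_mul]
  rw [integral_gaussianReal_zero_one, integral_gaussianReal_zero_one,
    integral_pow_four_mul_stdNormalPDF, integral_sq_mul_stdNormalPDF]
  norm_num

theorem integrable_eval_mul_eval_stdNormalPi (i j : Fin n) :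
    Integrable (fun x => x i * x j) (stdNormalPi n) := by
  have h : ∀ i : Fin n, MemLp (fun x : Fin n → ℝ => x i) 2 (stdNormalPi n) := fun i =>
    (memLp_two_iff_integrable_sq (Measurable.aestronglyMeasurable (by fun_prop))).2
      (integrable_comp_eval (μ := fun _ : Fin n => gaussianReal 0 1) (i := i)
        (f := fun x : ℝ => x ^ 2) (integrable_pow_gaussianReal 2))
  exact (h i).integrable_mul (h j)

theorem integral_eval_mul_eval_stdNormalPi (i j : Fin n) :
    ∫ x, x i * x j ∂stdNormalPi n = if i = j then 1 else 0 := by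
  split_ifs with hij
  · subst hij
    simp only [← sq]
    rw [integral_comp_eval (μ := fun _ : Fin n => gaussianReal 0 1) (i := i) (f := fun x => x ^ 2)
      (by fun_prop),
      integral_gaussianReal_zero_one, integral_sq_mul_stdNormalPDF]
  · have h := (iIndepFun_pi (μ := fun _ : Fin n => gaussianReal 0 1) (X := fun _ x => x)
      (fun i => by fun_prop)).indepFun hij
    have h2 := h.integral_fun_mul_eq_mul_integral
      (measurable_pi_apply i).aestronglyMeasurable (measurable_pi_apply j).aestronglyMeasurable
    rw [h2, integral_eval_stdNormalPi, zero_mul]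

theorem integrable_sum_sq_stdNormalPi :
    Integrable (fun x => ∑ i, x i ^ 2) (stdNormalPi n) :=
  integrable_finsetSum _ fun i _ => by
    simpa [sq] using integrable_eval_mul_eval_stdNormalPi i i

theorem integral_sum_sq_stdNormalPi : ∫ x, ∑ i, x i ^ 2 ∂stdNormalPi n = n := by
  rw [integral_finsetSum _ fun i _ => by simpa [sq] using integrable_eval_mul_eval_stdNormalPi i i]
  simp [sq, integral_eval_mul_eval_stdNormalPi]

theorem memLp_sum_sq_stdNormalPi : MemLp (fun x => ∑ i, x i ^ 2) 2 (stdNormalPi n) :=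
  memLp_finsetSum _ fun i _ =>
    memLp_sq_gaussianReal.comp_measurePreserving (measurePreserving_eval _ i)

theorem integrable_sum_sq_sq_stdNormalPi :
    Integrable (fun x => (∑ i, x i ^ 2) ^ 2) (stdNormalPi n) :=
  memLp_sum_sq_stdNormalPi.integrable_sq

theorem integral_sum_sq_sq_stdNormalPi :
    ∫ x, (∑ i, x i ^ 2) ^ 2 ∂stdNormalPi n = n ^ 2 + 2 * n := by
  have h := variance_sum_pi (μ := fun _ : Fin n => gaussianReal 0 1)
    (X := fun _ x => x ^ 2) fun _ => memLp_sq_gaussianReal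
  have h2 : (∑ i, fun x : Fin n → ℝ => x i ^ 2) = fun x => ∑ i, x i ^ 2 := by
    ext x; simp
  rw [h2, variance_eq_sub memLp_sum_sq_stdNormalPi, integral_sum_sq_stdNormalPi] at h
  simp [variance_sq_gaussianReal] at h
  linarith

end StdNormalPi

theorem lintegral_inv_sqrt_pow_gammaMeasure {a r : ℝ} (ha : 0 < a) (hr : 0 < r) {k : ℕ}
    (hk : (k : ℝ) / 2 < a) :
    ∫⁻ w, ENNReal.ofReal ((Real.sqrt w)⁻¹ ^ k) ∂gammaMeasure a r =
      ENNReal.ofReal (r ^ ((k : ℝ) / 2) * (Real.Gamma (a - k / 2) / Real.Gamma a)) := by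
  have hG := Real.Gamma_pos_of_pos ha
  have hm : Measurable (gammaPDF a r) := (measurable_gammaPDFReal a r).ennreal_ofReal
  rw [gammaMeasure, lintegral_withDensity_eq_lintegral_mul _ hm (by fun_prop)]
  have h0 : ∫⁻ w, (gammaPDF a r * fun w => ENNReal.ofReal ((Real.sqrt w)⁻¹ ^ k)) w =
      ∫⁻ w in Set.Ioi 0, (gammaPDF a r * fun w => ENNReal.ofReal ((Real.sqrt w)⁻¹ ^ k)) w := by
    rw [← lintegral_add_compl _ (measurableSet_Ici (a := (0 : ℝ))), Set.compl_Ici, setLIntegral_congr Ioi_ae_eq_Ici]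
    rw [setLIntegral_congr_fun (g := 0) measurableSet_Iio fun x hx => by
      simp [gammaPDF_of_neg hx]]
    simp
  rw [h0, setLIntegral_congr_fun (g := fun x => ENNReal.ofReal (r ^ a / Real.Gamma a) *
    ENNReal.ofReal (x ^ (a - k / 2 - 1) * Real.exp (-(r * x)))) measurableSet_Ioi,
    lintegral_const_mul _ (by fun_prop), lintegral_rpow_mul_exp_neg_mul (by linarith) hr,
    ← ENNReal.ofReal_mul (by positivity)]
  · congr 1
    rw [show r ^ a / Real.Gamma a * (Real.Gamma (a - k / 2) * r ^ (-(a - k / 2))) =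
      (r ^ a * r ^ (-(a - k / 2))) * (Real.Gamma (a - k / 2) / Real.Gamma a) by ring,
      ← Real.rpow_add hr]
    congr 2
    ring
  · intro x (hx : 0 < x)
    simp only [Pi.mul_apply]
    rw [gammaPDF_of_nonneg hx.le, ← ENNReal.ofReal_mul (by positivity),
      ← ENNReal.ofReal_mul (by positivity)]
    congr 1
    have : (Real.sqrt x)⁻¹ ^ k = x ^ (-((k : ℝ) / 2)) := by
      rw [Real.rpow_neg hx.le, inv_pow, Real.sqrt_eq_rpow, ← Real.rpow_mul_natCast hx.le]
      ring_nf
    rw [this, show a - k / 2 - 1 = (a - 1) + -((k : ℝ) / 2) by ring, Real.rpow_add hx]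
    ring

theorem integrable_inv_sqrt_pow_gammaMeasure {a r : ℝ} (ha : 0 < a) (hr : 0 < r) {k : ℕ}
    (hk : (k : ℝ) / 2 < a) : Integrable (fun w => (Real.sqrt w)⁻¹ ^ k) (gammaMeasure a r) := by
  refine ⟨Measurable.aestronglyMeasurable (by fun_prop), ?_⟩
  rw [hasFiniteIntegral_iff_ofReal (ae_of_all _ fun w => by positivity),
    lintegral_inv_sqrt_pow_gammaMeasure ha hr hk]
  exact ENNReal.ofReal_lt_top

theorem integral_inv_sqrt_pow_gammaMeasure {a r : ℝ} (ha : 0 < a) (hr : 0 < r) {k : ℕ}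
    (hk : (k : ℝ) / 2 < a) :
    ∫ w, (Real.sqrt w)⁻¹ ^ k ∂gammaMeasure a r =
      r ^ ((k : ℝ) / 2) * (Real.Gamma (a - k / 2) / Real.Gamma a) := by
  have hG := Real.Gamma_pos_of_pos ha
  have hG' := Real.Gamma_pos_of_pos (sub_pos.2 hk)
  rw [integral_eq_lintegral_of_nonneg_ae (ae_of_all _ fun w => by simp only [Pi.zero_apply]; positivity)
    (Measurable.aestronglyMeasurable (by fun_prop)),
    lintegral_inv_sqrt_pow_gammaMeasure ha hr hk, ENNReal.toReal_ofReal (by positivity)]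

/-- Two consecutive even steps of the moments of the mixing variate. -/
theorem integral_inv_sqrt_pow_add_two_gammaMeasure {ν : ℝ} {k : ℕ} (hk : (k : ℝ) + 2 < ν) :
    ∫ w, (Real.sqrt w)⁻¹ ^ (k + 2) ∂gammaMeasure (ν / 2) (ν / 2) =
      ν / (ν - k - 2) * ∫ w, (Real.sqrt w)⁻¹ ^ k ∂gammaMeasure (ν / 2) (ν / 2) := by
  have hk0 : (0 : ℝ) ≤ k := k.cast_nonneg
  have hν : 0 < ν / 2 := by linarith
  have hd : ν - k - 2 ≠ 0 := by linarith
  rw [integral_inv_sqrt_pow_gammaMeasure hν hν (by push_cast; linarith),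
    integral_inv_sqrt_pow_gammaMeasure hν hν (by linarith)]
  have h1 : Real.Gamma (ν / 2 - k / 2) =
      (ν / 2 - k / 2 - 1) * Real.Gamma (ν / 2 - (k + 2 : ℕ) / 2) := by
    have := Real.Gamma_add_one (s := ν / 2 - (k + 2 : ℕ) / 2) (by push_cast; linarith)
    convert this using 2 <;> push_cast <;> ring
  have h2 : (ν / 2) ^ (((k + 2 : ℕ) : ℝ) / 2) = (ν / 2) ^ ((k : ℝ) / 2) * (ν / 2) := by
    rw [← Real.rpow_add_one hν.ne']
    congr 1; push_cast; ring
  rw [h1, h2]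
  field_simp

/-- The joint law of independent variates: the squared inverse scale, the skew-normal coordinate, and
`n` standard normal coordinates. -/
def skewTMixture (n : ℕ) (β ν : ℝ) : Measure (ℝ × ℝ × (Fin n → ℝ)) :=
  (gammaMeasure (ν / 2) (ν / 2)).prod ((skewNormalMeasure β).prod (stdNormalPi n))

/-- The canonical skew `t` vector, as a function of the mixture variates. -/
def skewTVec {n : ℕ} (p : ℝ × ℝ × (Fin n → ℝ)) : Fin (n + 1) → ℝ :=
  (Real.sqrt p.1)⁻¹ • (Fin.cons p.2.1 p.2.2 : Fin (n + 1) → ℝ)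

/-- The moments of the scale variate. -/
def scaleMoment (ν : ℝ) (k : ℕ) : ℝ :=
  ∫ w, (Real.sqrt w)⁻¹ ^ k ∂gammaMeasure (ν / 2) (ν / 2)

/-- The mean of `ST₁(0, 1, β, ν)`. -/
def skewTMean (β ν : ℝ) : ℝ :=
  scaleMoment ν 1 * (Real.sqrt (2 / Real.pi) * (β / Real.sqrt (1 + β ^ 2)))

section Moments

variable {n : ℕ} {β ν : ℝ}

theorem measurable_skewTVec : Measurable (skewTVec (n := n)) := by
  have := measurable_finCons n
  unfold skewTVec
  fun_prop

@[simp] theorem skewTVec_zero (p : ℝ × ℝ × (Fin n → ℝ)) :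
    skewTVec p 0 = (Real.sqrt p.1)⁻¹ * p.2.1 := by simp [skewTVec]

@[simp] theorem skewTVec_succ (p : ℝ × ℝ × (Fin n → ℝ)) (i : Fin n) :
    skewTVec p i.succ = (Real.sqrt p.1)⁻¹ * p.2.2 i := by simp [skewTVec]

theorem isProbabilityMeasure_skewTMixture (hν : 0 < ν) :
    IsProbabilityMeasure (skewTMixture n β ν) := by
  have := isProbabilityMeasure_gammaMeasure (half_pos hν) (half_pos hν)
  unfold skewTMixture
  infer_instance

theorem scaleMoment_zero (hν : 0 < ν) : scaleMoment ν 0 = 1 := by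
  have := isProbabilityMeasure_gammaMeasure (half_pos hν) (half_pos hν)
  simp [scaleMoment]

theorem scaleMoment_one (hν : 4 < ν) : scaleMoment ν 1 =
    Real.sqrt (ν / 2) * (Real.Gamma ((ν - 1) / 2) / Real.Gamma (ν / 2)) := by
  rw [scaleMoment, integral_inv_sqrt_pow_gammaMeasure (by linarith) (by linarith)
    (by norm_num; linarith), Real.sqrt_eq_rpow]
  norm_num [sub_div]

theorem scaleMoment_two (hν : 4 < ν) : scaleMoment ν 2 = ν / (ν - 2) := by
  have := integral_inv_sqrt_pow_add_two_gammaMeasure (ν := ν) (k := 0) (by norm_num; linarith)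
  rw [scaleMoment, this, ← scaleMoment, scaleMoment_zero (by linarith)]
  simp

theorem scaleMoment_three (hν : 4 < ν) : scaleMoment ν 3 = ν / (ν - 3) * scaleMoment ν 1 := by
  have := integral_inv_sqrt_pow_add_two_gammaMeasure (ν := ν) (k := 1) (by norm_num; linarith)
  rw [scaleMoment, this, ← scaleMoment]
  norm_num [sub_sub]

theorem scaleMoment_four (hν : 4 < ν) :
    scaleMoment ν 4 = ν / (ν - 4) * (ν / (ν - 2)) := by
  have := integral_inv_sqrt_pow_add_two_gammaMeasure (ν := ν) (k := 2) (by norm_num; linarith)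
  rw [scaleMoment, this, ← scaleMoment, scaleMoment_two hν]
  norm_num [sub_sub]

theorem sq_scaleMoment_one_le (hν : 4 < ν) : scaleMoment ν 1 ^ 2 ≤ scaleMoment ν 2 := by
  have := isProbabilityMeasure_gammaMeasure (show 0 < ν / 2 by linarith)
    (show 0 < ν / 2 by linarith)
  have hL : MemLp (fun w => (Real.sqrt w)⁻¹) 2 (gammaMeasure (ν / 2) (ν / 2)) :=
    (memLp_two_iff_integrable_sq (Measurable.aestronglyMeasurable (by fun_prop))).2
      (integrable_inv_sqrt_pow_gammaMeasure (by linarith) (by linarith) (by norm_num; linarith))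
  have h := variance_nonneg (fun w => (Real.sqrt w)⁻¹) (gammaMeasure (ν / 2) (ν / 2))
  rw [variance_eq_sub hL] at h
  simpa [scaleMoment] using h

theorem sq_skewTMean_lt (hν : 4 < ν) : skewTMean β ν ^ 2 < scaleMoment ν 2 := by
  have h1 := sq_scaleMoment_one_le hν
  have h2 : 0 < scaleMoment ν 2 := by
    rw [scaleMoment_two hν]; exact div_pos (by linarith) (by linarith)
  have h3 : β ^ 2 / (1 + β ^ 2) ≤ 1 := by
    rw [div_le_one (by positivity)]; linarith
  have h4 : 2 / Real.pi < 1 := by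
    rw [div_lt_one Real.pi_pos]; linarith [Real.pi_gt_three]
  have h5 : 0 < 2 / Real.pi := by positivity
  rw [skewTMean, mul_pow, mul_pow, div_pow, Real.sq_sqrt h5.le, Real.sq_sqrt (by positivity)]
  have h6 : 2 / Real.pi * (β ^ 2 / (1 + β ^ 2)) < 1 := by
    nlinarith
  have h7 : 0 ≤ 2 / Real.pi * (β ^ 2 / (1 + β ^ 2)) := by positivity
  nlinarith

theorem integrable_mixture_monomial (hν : 4 < ν) {j : ℕ} (hj : j ≤ 4) (k : ℕ)
    {h : (Fin n → ℝ) → ℝ} (hh : Integrable h (stdNormalPi n)) :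
    Integrable (fun p => (Real.sqrt p.1)⁻¹ ^ j * (p.2.1 ^ k * h p.2.2)) (skewTMixture n β ν) := by
  have hj' : (j : ℝ) ≤ 4 := by exact_mod_cast hj
  have := isProbabilityMeasure_gammaMeasure (show 0 < ν / 2 by linarith)
    (show 0 < ν / 2 by linarith)
  exact (integrable_inv_sqrt_pow_gammaMeasure (by linarith) (by linarith) (by linarith)).mul_prod
    ((integrable_pow_skewNormalMeasure β k).mul_prod hh)

theorem integral_mixture_monomial (hν : 4 < ν) (j k : ℕ) (h : (Fin n → ℝ) → ℝ) :
    ∫ p, (Real.sqrt p.1)⁻¹ ^ j * (p.2.1 ^ k * h p.2.2) ∂skewTMixture n β ν =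
      scaleMoment ν j * ((∫ x, x ^ k ∂skewNormalMeasure β) * ∫ x, h x ∂stdNormalPi n) := by
  have := isProbabilityMeasure_gammaMeasure (show 0 < ν / 2 by linarith)
    (show 0 < ν / 2 by linarith)
  rw [skewTMixture, integral_prod_mul (fun w => (Real.sqrt w)⁻¹ ^ j)
    (fun p : ℝ × (Fin n → ℝ) => p.1 ^ k * h p.2), integral_prod_mul (fun x => x ^ k) h, scaleMoment]

theorem integrable_skewTVec (hν : 4 < ν) (i : Fin (n + 1)) :
    Integrable (fun p => skewTVec p i) (skewTMixture n β ν) := by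
  induction i using Fin.cases with
  | zero =>
    have := integrable_mixture_monomial (β := β) hν (j := 1) (by norm_num) 1
      (integrable_const (μ := stdNormalPi n) (1 : ℝ))
    simpa using this
  | succ i =>
    have := integrable_mixture_monomial (β := β) hν (j := 1) (by norm_num) 0
      (integrable_eval_stdNormalPi i)
    simpa using this

theorem integral_skewTVec (hν : 4 < ν) (i : Fin (n + 1)) :
    ∫ p, skewTVec p i ∂skewTMixture n β ν =
      (Pi.single 0 (skewTMean β ν) : Fin (n + 1) → ℝ) i := by
  induction i using Fin.cases with
  | zero =>
    have := integral_mixture_monomial (n := n) (β := β) hν 1 1 fun _ => 1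
    simpa [integral_id_skewNormalMeasure, skewTMean] using this
  | succ i =>
    have := integral_mixture_monomial (n := n) (β := β) hν 1 0 fun x => x i
    simpa [integral_eval_stdNormalPi] using this

theorem integrable_skewTVec_mul_skewTVec (hν : 4 < ν) (i j : Fin (n + 1)) :
    Integrable (fun p => skewTVec p i * skewTVec p j) (skewTMixture n β ν) := by
  induction i using Fin.cases with
  | zero => induction j using Fin.cases with
    | zero =>
      refine (integrable_mixture_monomial hν (j := 2) (by norm_num) 2
        (integrable_const (1 : ℝ))).congr (ae_of_all _ fun p => ?_)
      simp only [skewTVec_zero]; ring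
    | succ j =>
      refine (integrable_mixture_monomial hν (j := 2) (by norm_num) 1
        (integrable_eval_stdNormalPi j)).congr (ae_of_all _ fun p => ?_)
      simp only [skewTVec_zero, skewTVec_succ]; ring
  | succ i => induction j using Fin.cases with
    | zero =>
      refine (integrable_mixture_monomial hν (j := 2) (by norm_num) 1
        (integrable_eval_stdNormalPi i)).congr (ae_of_all _ fun p => ?_)
      simp only [skewTVec_zero, skewTVec_succ]; ring
    | succ j =>
      refine (integrable_mixture_monomial hν (j := 2) (by norm_num) 0
        (integrable_eval_mul_eval_stdNormalPi i j)).congr (ae_of_all _ fun p => ?_)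
      simp only [skewTVec_succ]; ring

theorem integral_skewTVec_mul_skewTVec (hν : 4 < ν) (i j : Fin (n + 1)) :
    ∫ p, skewTVec p i * skewTVec p j ∂skewTMixture n β ν =
      if i = j then scaleMoment ν 2 else 0 := by
  induction i using Fin.cases with
  | zero => induction j using Fin.cases with
    | zero =>
      have := integral_mixture_monomial (n := n) (β := β) hν 2 2 fun _ => 1
      rw [integral_sq_skewNormalMeasure] at this
      simp only [skewTVec_zero]
      simpa [mul_pow, ← sq] using this
    | succ j =>
      have := integral_mixture_monomial (n := n) (β := β) hν 2 1 fun x => x j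
      rw [integral_eval_stdNormalPi] at this
      simp only [skewTVec_zero, skewTVec_succ, (Fin.succ_ne_zero j).symm, if_false]
      simp only [mul_zero] at this
      rw [← this]
      congr 1; ext p; ring
  | succ i => induction j using Fin.cases with
    | zero =>
      have := integral_mixture_monomial (n := n) (β := β) hν 2 1 fun x => x i
      rw [integral_eval_stdNormalPi] at this
      simp only [skewTVec_zero, skewTVec_succ, Fin.succ_ne_zero i, if_false]
      simp only [mul_zero] at this
      rw [← this]
      congr 1; ext p; ring
    | succ j =>
      have := integral_mixture_monomial (n := n) (β := β) hν 2 0 fun x => x i * x j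
      rw [integral_eval_mul_eval_stdNormalPi] at this
      simp only [skewTVec_succ, Fin.succ_inj]
      simp only [pow_zero, integral_const, one_mul, mul_ite, mul_one, mul_zero, smul_eq_mul,
        probReal_univ] at this
      rw [← this]
      congr 1; ext p; ring

/-- The diagonal of the covariance matrix of the canonical skew `t` vector. -/
def skewTVar (n : ℕ) (β ν : ℝ) : Fin (n + 1) → ℝ :=
  Fin.cons (scaleMoment ν 2 - skewTMean β ν ^ 2) fun _ => scaleMoment ν 2

/-- The centered canonical skew `t` vector. -/
def skewTCentered {n : ℕ} (β ν : ℝ) (p : ℝ × ℝ × (Fin n → ℝ)) : Fin (n + 1) → ℝ :=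
  skewTVec p - Pi.single 0 (skewTMean β ν)

theorem skewTCentered_mul (i j : Fin (n + 1)) (p : ℝ × ℝ × (Fin n → ℝ)) :
    skewTCentered β ν p i * skewTCentered β ν p j = skewTVec p i * skewTVec p j -
      (Pi.single 0 (skewTMean β ν) : Fin (n + 1) → ℝ) i * skewTVec p j -
      (Pi.single 0 (skewTMean β ν) : Fin (n + 1) → ℝ) j * skewTVec p i +
      (Pi.single 0 (skewTMean β ν) : Fin (n + 1) → ℝ) i *
        (Pi.single 0 (skewTMean β ν) : Fin (n + 1) → ℝ) j := by
  simp only [skewTCentered, Pi.sub_apply]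
  ring

theorem integrable_skewTCentered_mul (hν : 4 < ν) (i j : Fin (n + 1)) :
    Integrable (fun p => skewTCentered β ν p i * skewTCentered β ν p j) (skewTMixture n β ν) := by
  have := isProbabilityMeasure_skewTMixture (n := n) (β := β) (show 0 < ν by linarith)
  simp only [skewTCentered_mul]
  exact (((integrable_skewTVec_mul_skewTVec hν i j).sub
    ((integrable_skewTVec hν j).const_mul _)).sub
    ((integrable_skewTVec hν i).const_mul _)).add (integrable_const _)

theorem integral_skewTCentered_mul (hν : 4 < ν) (i j : Fin (n + 1)) :
    ∫ p, skewTCentered β ν p i * skewTCentered β ν p j ∂skewTMixture n β ν =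
      diagonal (skewTVar n β ν) i j := by
  have := isProbabilityMeasure_skewTMixture (n := n) (β := β) (show 0 < ν by linarith)
  have h1 := integrable_skewTVec_mul_skewTVec (β := β) hν i j
  have h2 := integrable_skewTVec (n := n) (β := β) hν
  simp only [skewTCentered_mul]
  rw [integral_add (by fun_prop) (by fun_prop), integral_sub (by fun_prop) (by fun_prop),
    integral_sub (by fun_prop) (by fun_prop), integral_const_mul, integral_const_mul,
    integral_skewTVec hν, integral_skewTVec hν, integral_skewTVec_mul_skewTVec hν]
  induction i using Fin.cases with
  | zero => induction j using Fin.cases with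
    | zero => simp [skewTVar]; ring
    | succ j => simp [(Fin.succ_ne_zero j).symm]
  | succ i => induction j using Fin.cases with
    | zero => simp [Fin.succ_ne_zero i]
    | succ j => simp [diagonal_apply, skewTVar]

theorem integrable_skewTCentered_zero_pow_four (hν : 4 < ν) :
    Integrable (fun p => skewTCentered β ν p 0 ^ 4) (skewTMixture n β ν) := by
  have h : ∀ k ≤ 4, Integrable (fun p => (skewTMean β ν) ^ (4 - k) * ((Real.sqrt p.1)⁻¹ ^ k *
      (p.2.1 ^ k * 1))) (skewTMixture n β ν) := fun k hk =>
    (integrable_mixture_monomial hν hk k (integrable_const (1 : ℝ))).const_mul _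
  refine ((((h 4 le_rfl).sub ((h 3 (by norm_num)).const_mul 4)).add
    ((h 2 (by norm_num)).const_mul 6)).sub ((h 1 (by norm_num)).const_mul 4)).add
    (h 0 (by norm_num)) |>.congr (ae_of_all _ fun p => ?_)
  simp [skewTCentered]
  ring

theorem integral_sq_sum_skewTCentered (hν : 4 < ν) :
    ∫ p, (∑ i, skewTCentered β ν p i ^ 2 / skewTVar n β ν i) ^ 2 ∂skewTMixture n β ν =
      (∫ p, skewTCentered β ν p 0 ^ 4 ∂skewTMixture n β ν) /
          (scaleMoment ν 2 - skewTMean β ν ^ 2) ^ 2 +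
        2 * n / (scaleMoment ν 2 - skewTMean β ν ^ 2) * (ν / (ν - 4) -
          (ν - 1) * skewTMean β ν ^ 2 / (ν - 3)) + (n ^ 2 + 2 * n) * (ν - 2) / (ν - 4) := by
  set m := skewTMean β ν with hm
  set c := scaleMoment ν 2 - m ^ 2 with hc
  set e := scaleMoment ν 2 with he
  have hc0 : c ≠ 0 := (sub_pos.2 (sq_skewTMean_lt hν)).ne'
  have hexp : ∀ p : ℝ × ℝ × (Fin n → ℝ),
      (∑ i, skewTCentered β ν p i ^ 2 / skewTVar n β ν i) ^ 2 =
        (1 / c ^ 2) * skewTCentered β ν p 0 ^ 4 + (2 / (c * e)) *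
          ((Real.sqrt p.1)⁻¹ ^ 4 * (p.2.1 ^ 2 * ∑ i, p.2.2 i ^ 2)) - (4 * m / (c * e)) *
          ((Real.sqrt p.1)⁻¹ ^ 3 * (p.2.1 ^ 1 * ∑ i, p.2.2 i ^ 2)) + (2 * m ^ 2 / (c * e)) *
          ((Real.sqrt p.1)⁻¹ ^ 2 * (p.2.1 ^ 0 * ∑ i, p.2.2 i ^ 2)) + (1 / e ^ 2) *
          ((Real.sqrt p.1)⁻¹ ^ 4 * (p.2.1 ^ 0 * (∑ i, p.2.2 i ^ 2) ^ 2)) := by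
    intro p
    rw [Fin.sum_univ_succ]
    simp only [skewTVar, Fin.cons_zero, Fin.cons_succ, skewTCentered, Pi.sub_apply, skewTVec_zero,
      skewTVec_succ, Pi.single_eq_same, Pi.single_eq_of_ne (Fin.succ_ne_zero _), sub_zero, mul_pow,
      ← Finset.sum_div, ← Finset.mul_sum, ← hm, ← he, ← hc]
    ring_nf
  have hR := integrable_sum_sq_stdNormalPi (n := n)
  have i1 := (integrable_skewTCentered_zero_pow_four (n := n) (β := β) hν).const_mul (1 / c ^ 2)
  have i2 := (integrable_mixture_monomial (β := β) hν (j := 4) le_rfl 2 hR).const_mul (2 / (c * e))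
  have i3 := (integrable_mixture_monomial (β := β) hν (j := 3) (by norm_num) 1 hR).const_mul
    (4 * m / (c * e))
  have i4 := (integrable_mixture_monomial (β := β) hν (j := 2) (by norm_num) 0 hR).const_mul
    (2 * m ^ 2 / (c * e))
  have i5 := (integrable_mixture_monomial (β := β) hν (j := 4) le_rfl 0
    (integrable_sum_sq_sq_stdNormalPi (n := n))).const_mul (1 / e ^ 2)
  have hm1 : scaleMoment ν 3 * ∫ x, x ∂skewNormalMeasure β = ν / (ν - 3) * m := by
    rw [hm, skewTMean, scaleMoment_three hν, integral_id_skewNormalMeasure]; ring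
  simp only [hexp]
  rw [integral_add (by fun_prop) i5, integral_add (by fun_prop) i4,
    integral_sub (by fun_prop) i3, integral_add i1 i2]
  simp only [integral_const_mul]
  rw [integral_mixture_monomial hν 4 2 fun x => ∑ i, x i ^ 2,
    integral_mixture_monomial hν 3 1 fun x => ∑ i, x i ^ 2,
    integral_mixture_monomial hν 2 0 fun x => ∑ i, x i ^ 2,
    integral_mixture_monomial hν 4 0 fun x => (∑ i, x i ^ 2) ^ 2,
    integral_sum_sq_sq_stdNormalPi, integral_sum_sq_stdNormalPi, integral_sq_skewNormalMeasure]
  simp only [pow_one, pow_zero, integral_const, probReal_univ, smul_eq_mul, one_mul]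
  rw [← mul_assoc (scaleMoment ν 3), hm1, scaleMoment_four hν, ← he]
  have h2 : ν - 2 ≠ 0 := by linarith
  have h3 : ν - 3 ≠ 0 := by linarith
  have h4 : ν - 4 ≠ 0 := by linarith
  have h0 : ν ≠ 0 := by linarith
  have he' : e = ν / (ν - 2) := scaleMoment_two hν
  clear_value c m e
  subst he'
  field_simp
  ring

end Moments

theorem map_skewTVec_zero (n : ℕ) (β : ℝ) {ν : ℝ} (hν : 0 < ν) :
    Measure.map (fun p => skewTVec p 0) (skewTMixture n β ν) =
      volume.withDensity fun x => ENNReal.ofReal (st1PDF β ν x) := by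
  have := isProbabilityMeasure_gammaMeasure (half_pos hν) (half_pos hν)
  have h := Measure.map_prod_map (gammaMeasure (ν / 2) (ν / 2))
    ((skewNormalMeasure β).prod (stdNormalPi n)) measurable_id measurable_fst
  rw [Measure.map_id, measurePreserving_fst.map_eq] at h
  rw [withDensity_st1PDF β hν, h, Measure.map_map (by fun_prop) (by fun_prop), skewTMixture]
  congr 1

theorem map_add_withDensity_stPDF_zero {d : ℕ} (ξ : Fin d → ℝ) (S : Matrix (Fin d) (Fin d) ℝ)
    (α : Fin d → ℝ) (ν : ℝ) :
    Measure.map (fun y => ξ + y) (volume.withDensity fun y => ENNReal.ofReal (stPDF 0 S α ν y)) =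
      volume.withDensity fun y => ENNReal.ofReal (stPDF ξ S α ν y) := by
  have h : (fun y => ENNReal.ofReal (stPDF 0 S α ν y)) =
      (fun y => ENNReal.ofReal (stPDF ξ S α ν y)) ∘ (fun y => ξ + y) := by
    ext y
    simp [stPDF_eq_stPDF_zero_sub ξ]
  ext s hs
  have he := (MeasurableEquiv.addLeft ξ).measurableEmbedding
  have hp := measurePreserving_add_left (volume : Measure (Fin d → ℝ)) ξ
  rw [Measure.map_apply (by fun_prop) hs, withDensity_apply _ (by measurability),
    withDensity_apply _ hs, h]
  exact hp.setLIntegral_comp_preimage_emb he (fun y => ENNReal.ofReal (stPDF ξ S α ν y)) s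

section Parameters

variable {d : ℕ} {S : Matrix (Fin d) (Fin d) ℝ}

theorem isUnit_det_scaleMat (hS : S.PosDef) : IsUnit (scaleMat S).det := by
  rw [scaleMat, det_diagonal, isUnit_iff_ne_zero, Finset.prod_ne_zero_iff]
  exact fun i _ => (Real.sqrt_pos.2 hS.diag_pos).ne'

theorem transpose_inv_scaleMat : ((scaleMat S)⁻¹)ᵀ = (scaleMat S)⁻¹ := by
  rw [transpose_nonsing_inv, scaleMat, diagonal_transpose]

theorem dotProduct_corrMat_mulVec (α : Fin d → ℝ) :
    α ⬝ᵥ (corrMat S *ᵥ α) = ((scaleMat S)⁻¹ *ᵥ α) ⬝ᵥ (S *ᵥ ((scaleMat S)⁻¹ *ᵥ α)) := by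
  rw [corrMat, ← mulVec_mulVec, ← mulVec_mulVec, dotProduct_mulVec, ← mulVec_transpose,
    transpose_inv_scaleMat]

theorem isUnit_det_corrMat (hS : S.PosDef) : IsUnit (corrMat S).det := by
  have h := isUnit_det_scaleMat hS
  rw [corrMat, det_mul, det_mul]
  exact ((isUnit_nonsing_inv_det _ h).mul hS.det_pos.ne'.isUnit).mul (isUnit_nonsing_inv_det _ h)

theorem dotProduct_corrMat_mulVec_nonneg (hS : S.PosDef) (α : Fin d → ℝ) :
    0 ≤ α ⬝ᵥ (corrMat S *ᵥ α) := by
  rw [dotProduct_corrMat_mulVec]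
  simpa using hS.posSemidef.dotProduct_mulVec_nonneg ((scaleMat S)⁻¹ *ᵥ α)

theorem sqrt_deltaOf_dotProduct (hS : S.PosDef) (α : Fin d → ℝ) :
    Real.sqrt (deltaOf (corrMat S) α ⬝ᵥ ((corrMat S)⁻¹ *ᵥ deltaOf (corrMat S) α)) =
      Real.sqrt (α ⬝ᵥ (corrMat S *ᵥ α)) / Real.sqrt (1 + α ⬝ᵥ (corrMat S *ᵥ α)) := by
  have h0 := dotProduct_corrMat_mulVec_nonneg hS α
  rw [deltaOf, mulVec_smul, mulVec_mulVec, nonsing_inv_mul _ (isUnit_det_corrMat hS), one_mulVec,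
    smul_dotProduct, dotProduct_smul, dotProduct_comm (corrMat S *ᵥ α) α, smul_eq_mul, smul_eq_mul, ← mul_assoc,
    ← mul_inv, Real.mul_self_sqrt (by positivity), ← div_eq_inv_mul, Real.sqrt_div h0]

theorem sqrt_deltaOf_mul_eq_skewTMean (hS : S.PosDef) (α : Fin d → ℝ) {ν : ℝ} (hν : 4 < ν) :
    Real.sqrt (deltaOf (corrMat S) α ⬝ᵥ ((corrMat S)⁻¹ *ᵥ deltaOf (corrMat S) α)) *
        Real.sqrt (ν / Real.pi) * (Real.Gamma ((ν - 1) / 2) / Real.Gamma (ν / 2)) =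
      skewTMean (Real.sqrt (α ⬝ᵥ (corrMat S *ᵥ α))) ν := by
  have h0 := dotProduct_corrMat_mulVec_nonneg hS α
  rw [sqrt_deltaOf_dotProduct hS, skewTMean, scaleMoment_one hν, Real.sq_sqrt h0,
    show ν / Real.pi = ν / 2 * (2 / Real.pi) by field_simp,
    Real.sqrt_mul (show 0 ≤ ν / 2 by linarith)]
  ring

end Parameters

theorem dotProduct_inv_mul_diagonal_mul_transpose_mulVec {ι : Type*} [Fintype ι] [DecidableEq ι]
    {A : Matrix ι ι ℝ} (hA : A.det ≠ 0) {c : ι → ℝ} (hc : ∀ i, c i ≠ 0) (v : ι → ℝ) :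
    (A *ᵥ v) ⬝ᵥ ((A * diagonal c * Aᵀ)⁻¹ *ᵥ (A *ᵥ v)) = ∑ i, v i ^ 2 / c i := by
  have hAu : IsUnit A.det := isUnit_iff_ne_zero.2 hA
  have hd : (diagonal c)⁻¹ = diagonal fun i => (c i)⁻¹ := by
    refine inv_eq_left_inv ?_
    rw [diagonal_mul_diagonal, ← diagonal_one]
    congr 1
    ext i
    exact inv_mul_cancel₀ (hc i)
  rw [Matrix.mul_inv_rev, Matrix.mul_inv_rev, hd, ← mulVec_mulVec, ← mulVec_mulVec,
    mulVec_mulVec _ A⁻¹, nonsing_inv_mul A hAu, one_mulVec, ← transpose_nonsing_inv,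
    dotProduct_mulVec, vecMul_transpose, mulVec_mulVec, nonsing_inv_mul A hAu, one_mulVec]
  simp only [dotProduct, mulVec_diagonal]
  exact Finset.sum_congr rfl fun i _ => by ring

/-- The stochastic representation of a skew `t` vector. -/
theorem IsST.exists_map_eq {Ω' : Type*} [MeasurableSpace Ω'] {P : Measure Ω'} {n : ℕ}
    {Y : Ω' → Fin (n + 1) → ℝ} {ξ α : Fin (n + 1) → ℝ}
    {S : Matrix (Fin (n + 1)) (Fin (n + 1)) ℝ} (hS : S.PosDef) {ν : ℝ} (hν : 0 < ν)
    (hY : IsST P Y ξ S α ν) : ∃ A : Matrix (Fin (n + 1)) (Fin (n + 1)) ℝ, A.det ≠ 0 ∧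
      Measure.map Y P = Measure.map (fun p => ξ + A *ᵥ skewTVec p)
        (skewTMixture n (Real.sqrt (α ⬝ᵥ (corrMat S *ᵥ α))) ν) := by
  obtain ⟨A, hA, hAA, hAc⟩ :=
    hS.exists_mul_transpose_eq_and_mulVec_eq_single ((scaleMat S)⁻¹ *ᵥ α)
  rw [← dotProduct_corrMat_mulVec] at hAc
  refine ⟨A, hA, ?_⟩
  have hm := measurable_skewTVec (n := n)
  have h := withDensity_stPDF_zero hA α (hAA.symm ▸ hAc) hν
  rw [hAA] at h
  rw [IsST] at hY
  rw [hY, ← map_add_withDensity_stPDF_zero, h, Measure.map_map (by fun_prop) (by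
    have := measurable_finCons n
    fun_prop)]
  rw [skewTMixture]
  congr 1
  ext1 p
  simp [skewTVec, mulVec_smul]

section Transfer

variable {Ω' : Type*} [MeasurableSpace Ω'] {P : Measure Ω'} {n : ℕ} {Y : Ω' → Fin (n + 1) → ℝ}
  {ξ : Fin (n + 1) → ℝ} {A : Matrix (Fin (n + 1)) (Fin (n + 1)) ℝ} {β ν : ℝ}

theorem integral_comp_eq_of_map_eq (hYm : Measurable Y)
    (hY : Measure.map Y P = Measure.map (fun p => ξ + A *ᵥ skewTVec p) (skewTMixture n β ν))
    {F : (Fin (n + 1) → ℝ) → ℝ} (hF : Measurable F) :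
    ∫ t, F (Y t) ∂P = ∫ p, F (ξ + A *ᵥ skewTVec p) ∂skewTMixture n β ν := by
  have hm := measurable_skewTVec (n := n)
  rw [← integral_map (f := F) hYm.aemeasurable hF.aestronglyMeasurable, hY,
    integral_map (Measurable.aemeasurable (by fun_prop)) hF.aestronglyMeasurable]

theorem integral_eq_of_map_eq (hν : 4 < ν) (hYm : Measurable Y)
    (hY : Measure.map Y P = Measure.map (fun p => ξ + A *ᵥ skewTVec p) (skewTMixture n β ν)) :
    (fun i => ∫ t, Y t i ∂P) = ξ + A *ᵥ Pi.single 0 (skewTMean β ν) := by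
  have := isProbabilityMeasure_skewTMixture (n := n) (β := β) (show 0 < ν by linarith)
  ext i
  have hi := fun j => (integrable_skewTVec (n := n) (β := β) hν j).const_mul (A i j)
  rw [integral_comp_eq_of_map_eq hYm hY (F := fun y => y i) (by fun_prop)]
  simp only [Pi.add_apply, mulVec, dotProduct]
  rw [integral_add (integrable_const _) (integrable_finsetSum _ fun j _ => hi j),
    integral_finsetSum _ fun j _ => hi j]
  simp only [integral_const_mul, integral_skewTVec hν]
  simp

theorem covariance_eq_of_map_eq (hν : 4 < ν) (hYm : Measurable Y)
    (hY : Measure.map Y P = Measure.map (fun p => ξ + A *ᵥ skewTVec p) (skewTMixture n β ν)) :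
    (Matrix.of fun i j => ∫ t, (Y t i - (ξ + A *ᵥ Pi.single 0 (skewTMean β ν)) i) *
      (Y t j - (ξ + A *ᵥ Pi.single 0 (skewTMean β ν)) j) ∂P) =
      A * diagonal (skewTVar n β ν) * Aᵀ := by
  ext i j
  have hi := fun k l => (integrable_skewTCentered_mul (n := n) (β := β) hν k l).const_mul
    (A i k * A j l)
  have hcenter : ∀ (p : ℝ × ℝ × (Fin n → ℝ)) i, (ξ + A *ᵥ skewTVec p) i -
      (ξ + A *ᵥ Pi.single 0 (skewTMean β ν)) i = ∑ k, A i k * skewTCentered β ν p k := by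
    intro p i
    rw [← Pi.sub_apply, add_sub_add_left_eq_sub, ← mulVec_sub]
    rfl
  rw [of_apply, integral_comp_eq_of_map_eq hYm hY
    (F := fun y => (y i - (ξ + A *ᵥ Pi.single 0 (skewTMean β ν)) i) *
      (y j - (ξ + A *ᵥ Pi.single 0 (skewTMean β ν)) j)) (by fun_prop)]
  simp only [hcenter, Finset.sum_mul_sum, mul_mul_mul_comm]
  rw [integral_finsetSum _ fun k _ => integrable_finsetSum _ fun l _ => hi k l]
  simp_rw [integral_finsetSum _ fun l _ => hi _ l, integral_const_mul,
    integral_skewTCentered_mul hν]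
  simp [mul_apply, diagonal_apply, mul_right_comm]

theorem integral_mahalanobis_sq_of_map_eq (hν : 4 < ν) (hA : A.det ≠ 0) (hYm : Measurable Y)
    (hY : Measure.map Y P = Measure.map (fun p => ξ + A *ᵥ skewTVec p) (skewTMixture n β ν)) :
    ∫ t, ((Y t - (ξ + A *ᵥ Pi.single 0 (skewTMean β ν))) ⬝ᵥ
      ((A * diagonal (skewTVar n β ν) * Aᵀ)⁻¹ *ᵥ
        (Y t - (ξ + A *ᵥ Pi.single 0 (skewTMean β ν))))) ^ 2 ∂P =
      ∫ p, (∑ i, skewTCentered β ν p i ^ 2 / skewTVar n β ν i) ^ 2 ∂skewTMixture n β ν := by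
  have hc : ∀ i, skewTVar n β ν i ≠ 0 := by
    intro i
    induction i using Fin.cases with
    | zero => exact (sub_pos.2 (sq_skewTMean_lt hν)).ne'
    | succ i => exact ((sq_nonneg _).trans_lt (sq_skewTMean_lt (β := 0) hν)).ne'
  rw [integral_comp_eq_of_map_eq hYm hY (F := fun y =>
    ((y - (ξ + A *ᵥ Pi.single 0 (skewTMean β ν))) ⬝ᵥ ((A * diagonal (skewTVar n β ν) * Aᵀ)⁻¹ *ᵥ
        (y - (ξ + A *ᵥ Pi.single 0 (skewTMean β ν))))) ^ 2) (by fun_prop)]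
  simp only [add_sub_add_left_eq_sub, ← mulVec_sub]
  simp only [← dotProduct_inv_mul_diagonal_mul_transpose_mulVec hA hc]
  rfl

end Transfer

section Univariate

variable {Ω' : Type*} [MeasurableSpace Ω'] {P : Measure Ω'} {T : Ω' → ℝ} {β ν : ℝ}

theorem integral_comp_eq_of_map_eq_st1PDF (n : ℕ) (hν : 0 < ν) (hTm : Measurable T)
    (hT : Measure.map T P = volume.withDensity fun x => ENNReal.ofReal (st1PDF β ν x))
    {F : ℝ → ℝ} (hF : Measurable F) :
    ∫ t, F (T t) ∂P = ∫ p, F (skewTVec p 0) ∂skewTMixture n β ν := by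
  have hm := measurable_skewTVec (n := n)
  rw [← integral_map (f := F) hTm.aemeasurable hF.aestronglyMeasurable, hT,
    ← map_skewTVec_zero n β hν,
    integral_map (Measurable.aemeasurable (by fun_prop)) hF.aestronglyMeasurable]

theorem integral_eq_skewTMean (hν : 4 < ν) (hTm : Measurable T)
    (hT : Measure.map T P = volume.withDensity fun x => ENNReal.ofReal (st1PDF β ν x)) :
    ∫ t, T t ∂P = skewTMean β ν := by
  rw [integral_comp_eq_of_map_eq_st1PDF 0 (by linarith) hTm hT (F := fun x => x) measurable_id,
    integral_skewTVec hν, Pi.single_eq_same]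

theorem integral_centered_pow_eq (n : ℕ) (hν : 4 < ν) (hTm : Measurable T)
    (hT : Measure.map T P = volume.withDensity fun x => ENNReal.ofReal (st1PDF β ν x)) (k : ℕ) :
    ∫ t, (T t - skewTMean β ν) ^ k ∂P =
      ∫ p, skewTCentered β ν p 0 ^ k ∂skewTMixture n β ν := by
  rw [integral_comp_eq_of_map_eq_st1PDF n (by linarith) hTm hT
    (F := fun x => (x - skewTMean β ν) ^ k) (by fun_prop)]
  simp [skewTCentered]

theorem integral_centered_sq_eq (hν : 4 < ν) (hTm : Measurable T)
    (hT : Measure.map T P = volume.withDensity fun x => ENNReal.ofReal (st1PDF β ν x)) :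
    ∫ t, (T t - skewTMean β ν) ^ 2 ∂P = scaleMoment ν 2 - skewTMean β ν ^ 2 := by
  have h := integral_skewTCentered_mul (n := 0) (β := β) hν 0 0
  simp only [← sq] at h
  rw [integral_centered_pow_eq 0 hν hTm hT, h]
  simp [skewTVar]

theorem integral_pow_four_eq_of_zero (hν : 4 < ν) (hTm : Measurable T)
    (hT : Measure.map T P = volume.withDensity fun x => ENNReal.ofReal (st1PDF β ν x)) :
    ∫ t, T t ^ 4 ∂P = 3 * scaleMoment ν 4 := by
  have h := integral_mixture_monomial (n := 0) (β := β) hν 4 4 fun _ => 1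
  rw [integral_pow_four_skewNormalMeasure] at h
  rw [integral_comp_eq_of_map_eq_st1PDF 0 (by linarith) hTm hT (F := fun x => x ^ 4) (by fun_prop)]
  simp only [skewTVec_zero, mul_pow]
  simpa [mul_comm] using h

end Univariate

/-- Mardia's multivariate excess kurtosis index of the multivariate
skew `t` distribution `ST_d(ξ, Ω, α, ν)`, `ν > 4`. -/
theorem mardia_kurtosis_skew_t
    {Ω' : Type*} [MeasurableSpace Ω'] (P : MeasureTheory.Measure Ω')
    [MeasureTheory.IsProbabilityMeasure P]
    {d : ℕ} (α ξ : Fin d → ℝ) (Ωm : Matrix (Fin d) (Fin d) ℝ) (hΩ : Ωm.PosDef)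
    (ν : ℝ) (hν : 4 < ν)
    (Y : Ω' → Fin d → ℝ) (hYmeas : Measurable Y) (hY : IsST P Y ξ Ωm α ν)
    -- `T ~ ST₁(0, 1, α*, ν)`, a univariate skew t variate
    (T : Ω' → ℝ) (hTmeas : Measurable T)
    (hT : Measure.map T P = volume.withDensity fun x =>
      ENNReal.ofReal (st1PDF (Real.sqrt (α ⬝ᵥ (corrMat Ωm *ᵥ α))) ν x)) :
    let δ := deltaOf (corrMat Ωm) α
    let δstar := Real.sqrt (δ ⬝ᵥ ((corrMat Ωm)⁻¹ *ᵥ δ))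
    let μstar := δstar * Real.sqrt (ν / Real.pi) *
      (Real.Gamma ((ν - 1) / 2) / Real.Gamma (ν / 2))
    let σstar2 := ν / (ν - 2) - μstar ^ 2
    let μ : Fin d → ℝ := fun i => ∫ t, Y t i ∂P
    let Sig : Matrix (Fin d) (Fin d) ℝ :=
      Matrix.of fun i j => ∫ t, (Y t i - μ i) * (Y t j - μ j) ∂P
    let mT := ∫ t, T t ∂P
    let β2star := (∫ t, (T t - mT) ^ 4 ∂P) / (∫ t, (T t - mT) ^ 2 ∂P) ^ 2
    -- Mardia's excess kurtosis index γ_{2,d} of Y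
    (∫ t, ((Y t - μ) ⬝ᵥ (Sig⁻¹ *ᵥ (Y t - μ))) ^ 2 ∂P) - d * (d + 2)
      = β2star + ((d : ℝ) ^ 2 - 1) * (ν - 2) / (ν - 4) +
          2 * ((d : ℝ) - 1) / σstar2 * (ν / (ν - 4) - (ν - 1) * μstar ^ 2 / (ν - 3)) -
          (d : ℝ) * ((d : ℝ) + 2) := by
  intro δ δstar μstar σstar2 μ Sig mT β2star
  set β := Real.sqrt (α ⬝ᵥ (corrMat Ωm *ᵥ α)) with hβ
  have hμ : μstar = skewTMean β ν := sqrt_deltaOf_mul_eq_skewTMean hΩ α hν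
  have hmT : mT = skewTMean β ν := integral_eq_skewTMean hν hTmeas hT
  have hσ : σstar2 = scaleMoment ν 2 - skewTMean β ν ^ 2 := by
    rw [scaleMoment_two hν, ← hμ]
  have hvar : ∫ t, (T t - mT) ^ 2 ∂P = σstar2 := by
    rw [hmT, hσ, integral_centered_sq_eq hν hTmeas hT]
  have hβ2 : β2star = (∫ t, (T t - mT) ^ 4 ∂P) / σstar2 ^ 2 := by rw [← hvar]
  have h2 : ν - 2 ≠ 0 := by linarith
  have h4 : ν - 4 ≠ 0 := by linarith
  have h0 : ν ≠ 0 := by linarith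
  cases d with
  | zero =>
    have hm0 : skewTMean β ν = 0 := by simp [hβ, skewTMean]
    rw [hm0] at hμ hmT hσ
    simp only [hmT, sub_zero, integral_pow_four_eq_of_zero hν hTmeas hT] at hβ2
    rw [hβ2, hμ, hσ, scaleMoment_four hν, scaleMoment_two hν]
    simp
    field_simp
    ring
  | succ n =>
    obtain ⟨A, hA, hYA⟩ := hY.exists_map_eq hΩ (by linarith)
    rw [← hβ] at hYA
    have hmean : μ = ξ + A *ᵥ Pi.single 0 (skewTMean β ν) := integral_eq_of_map_eq hν hYmeas hYA
    have hSig : Sig = A * diagonal (skewTVar n β ν) * Aᵀ := by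
      rw [← covariance_eq_of_map_eq hν hYmeas hYA, ← hmean]
    rw [hSig, hmean, integral_mahalanobis_sq_of_map_eq hν hA hYmeas hYA,
      integral_sq_sum_skewTCentered hν, ← integral_centered_pow_eq n hν hTmeas hT, ← hσ, ← hμ, hβ2,
      hmT, ← hμ]
    push_cast
    ring

end
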